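/- Let A be a Noetherian reduced commutative ring and let A → B be an étale ring map. Let g : Y → Spec(B) be an M-morphism. Then there exists an M-morphism f : X → Spec(A) together with a morphism X ×_{Spec(A)} Spec(B) → Y of schemes over Spec(B). -/

import Mathlib

open AlgebraicGeometry CategoryTheory CategoryTheory.Limits

universe u

/-- The canonical map from `A` to the total ring of fractions of `A_red`. -/
noncomputable def totalFractionMap (A : Type u) [CommRing A] :
    CommRingCat.of A ⟶ CommRingCat.of (FractionRing (A ⧸ nilradical A)) :=
  CommRingCat.ofHom ((algebraMap (A ⧸ nilradical A) (FractionRing (A ⧸ nilradical A))).comp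
    (Ideal.Quotient.mk (nilradical A)))

/-- `f : X ⟶ Spec A` is an M-morphism if it is proper, of finite presentation, and its
base change to the total fraction ring of `A_red` is an isomorphism. -/
def IsMMorphism {A : Type u} [CommRing A] {X : Scheme.{u}}
    (f : X ⟶ Spec (CommRingCat.of A)) : Prop :=
  IsProper f ∧ LocallyOfFinitePresentation f ∧
    IsIso (pullback.snd f (Spec.map (totalFractionMap A)))

section
attribute [-instance] CategoryTheory.catToReflQuiver
set_option linter.style.haveILetI false

section
open Polynomial
lemma zinv_core {L : Type*} [Field L] (D : Type*) [CommRing D] [IsDomain D] [IsLocalRing D]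
    [Algebra D L] [IsFractionRing D L] [IsIntegrallyClosed D] (n : ℕ) (a : ℕ → D) (z : L) (hz : z ≠ 0)
    (h : ∑ j ∈ Finset.range n, algebraMap D L (a j) * z ^ j = 0) (i : ℕ) (hi : i < n) (hai : a i = 1) :
    IsLocalization.IsInteger D z ∨ IsLocalization.IsInteger D z⁻¹ := by
  have key : ∀ k, k ≤ n → ∃ c e : D, algebraMap D L e = algebraMap D L c * z ∧
      algebraMap D L c * z ^ k + ∑ j ∈ Finset.range k, algebraMap D L (a j) * z ^ j = 0 ∧
      (k < n → ∃ c' e' : D, algebraMap D L e' = algebraMap D L c' * z ∧ c = a k + e') := by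
    intro k hk
    induction hk using Nat.decreasingInduction with
    | self => exact ⟨0, 0, by simp, by simpa using h, fun h => absurd h (lt_irrefl _)⟩
    | of_succ k hk ih =>
      obtain ⟨c, e, h1, h2, -⟩ := ih
      have h2' : algebraMap D L (a k + e) * z ^ k + ∑ j ∈ Finset.range k, algebraMap D L (a j) * z ^ j = 0 := by
        rw [Finset.sum_range_succ] at h2
        rw [map_add, h1, ← h2]; ring
      have hint : _root_.IsIntegral D (algebraMap D L (a k + e) * z) := by
        by_cases hc : a k + e = 0
        · rw [hc]; simpa using isIntegral_zero
        rcases Nat.eq_zero_or_pos k with rfl | hk0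
        · exfalso; apply hc
          apply IsFractionRing.injective D L
          simpa using h2'
        let q : D[X] := ∑ j ∈ Finset.range k, C (a j) * X ^ j
        have hq : q.degree < k := by
          refine mem_degreeLT.mp (Submodule.sum_mem _ fun j hj => mem_degreeLT.mpr ?_)
          exact (degree_C_mul_X_pow_le _ _).trans_lt (by exact_mod_cast Finset.mem_range.mp hj)
        let p : D[X] := C (a k + e) * X ^ k + q
        have hdeg : (C (a k + e) * X ^ k : D[X]).degree = k := degree_C_mul_X_pow _ hc
        have hp : p.leadingCoeff = a k + e := by
          rw [leadingCoeff_add_of_degree_lt' (by rw [hdeg]; exact hq)]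
          rw [leadingCoeff_mul_X_pow, leadingCoeff_C]
        have := isIntegral_leadingCoeff_smul p z (by simpa [p, q] using h2')
        rwa [hp, Algebra.smul_def] at this
      obtain ⟨e'', he''⟩ := IsIntegrallyClosed.isIntegral_iff.mp hint
      exact ⟨a k + e, e'', he'', h2', fun _ => ⟨c, e, h1, rfl⟩⟩
  obtain ⟨c, e, h1, -, h3⟩ := key i hi.le
  obtain ⟨c', e', h4, h5⟩ := h3 hi
  have inv : ∀ d f : D, IsUnit d → algebraMap D L f = algebraMap D L d * z →
      IsLocalization.IsInteger D z := by
    rintro d f ⟨u, rfl⟩ hf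
    refine ⟨↑u⁻¹ * f, ?_⟩
    rw [map_mul, hf, ← mul_assoc, ← map_mul]; simp
  by_cases hc : IsUnit c
  · exact Or.inl (inv c e hc h1)
  · right
    have : IsUnit (-e') := by
      have : (1:D) = c + (-e') := by rw [h5, hai]; ring
      exact (IsLocalRing.isUnit_or_isUnit_of_isUnit_add (this ▸ isUnit_one)).resolve_left hc
    rw [IsUnit.neg_iff] at this
    obtain ⟨u, hu⟩ := this
    refine ⟨↑u⁻¹ * c', ?_⟩
    have hu0 : algebraMap D L (u:D) ≠ 0 := by
      have := (u.isUnit.map (algebraMap D L)).ne_zero; exact this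
    have e1 : algebraMap D L (↑u⁻¹ : D) * algebraMap D L u = 1 := by rw [← map_mul]; simp
    rw [← hu] at h4
    apply eq_inv_of_mul_eq_one_left; rw [map_mul, mul_assoc, ← h4, e1]

lemma val_of_normal {κ L : Type*} [Field κ] [Field L] [Algebra κ L] [Algebra.IsAlgebraic κ L]
    (V : ValuationSubring κ) (D : Type*) [CommRing D] [IsDomain D] [IsLocalRing D]
    [Algebra D L] [IsFractionRing D L] [IsIntegrallyClosed D]
    (hVD : ∀ v ∈ V, ∃ d, algebraMap D L d = algebraMap κ L v) : ValuationRing D := by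
  rw [ValuationRing.iff_isInteger_or_isInteger D (K := L)]
  intro z
  by_cases hz : z = 0
  · subst hz; exact Or.inl ⟨0, by simp⟩
  obtain ⟨p, hp0, hp⟩ := Algebra.IsAlgebraic.isAlgebraic (R := κ) z
  obtain ⟨i, hi, hmax⟩ := p.support.exists_max_image (fun j => V.valuation (p.coeff j))
    (by simpa using hp0)
  have hpi : p.coeff i ≠ 0 := by simpa using hi
  have hV : ∀ j, p.coeff j / p.coeff i ∈ V := by
    intro j
    rw [← V.valuation_le_one_iff, map_div₀]
    by_cases hj : p.coeff j = 0
    · simp [hj]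
    · exact div_le_one_of_le₀ (hmax j (by simpa using hj)) (zero_le)
  choose a ha using fun j => hVD _ (hV j)
  refine zinv_core D (p.natDegree + 1) a z hz ?_ i (Nat.lt_succ_of_le (le_natDegree_of_ne_zero hpi)) ?_
  · rw [aeval_eq_sum_range] at hp
    simp_rw [ha, map_div₀, div_mul_eq_mul_div, ← Finset.sum_div]
    simp_rw [Algebra.smul_def] at hp
    rw [hp, zero_div]
  · apply IsFractionRing.injective D L
    rw [ha, div_self hpi]; simp
end

section
open TensorProduct
noncomputable abbrev VB {A : Type u} (B : Type u) {κ : Type u} [CommRing A] [CommRing B] [Algebra A B] [CommRing κ] [Algebra A κ]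
    (V : Subalgebra A κ) : Subalgebra B (B ⊗[A] κ) :=
  (Algebra.TensorProduct.map (AlgHom.id B B) V.val).range

lemma integral_of_range {R S L : Type*} [CommRing R] [CommRing S] [CommRing L] (f : R →+* L) (g : S →+* L)
    (h : ∀ r, ∃ s, g s = f r) (x : L) (hx : f.IsIntegralElem x) : g.IsIntegralElem x := by
  choose σ hσ using h
  obtain ⟨p, hp, hpx⟩ := hx
  obtain ⟨q, hq, hq2⟩ := Polynomial.lifts_and_natDegree_eq_and_monic (f := g.rangeRestrict)
    (p := p.map (f.codRestrict g.range fun r => ⟨σ r, hσ r⟩)) (by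
        rw [Polynomial.lifts_iff_set_range]
        exact Polynomial.map_surjective _ (RingHom.rangeRestrict_surjective _) _) (hp.map _)
  refine ⟨q, hq2.2, ?_⟩
  have : p.eval₂ ((g.range.subtype).comp (f.codRestrict g.range fun r => ⟨σ r, hσ r⟩)) x = 0 := hpx
  rw [← Polynomial.eval₂_map, ← hq, Polynomial.eval₂_map] at this
  exact this

lemma closed_aux {V S κ L : Type*} [CommRing V] [CommRing S] [CommRing κ] [CommRing L] [Algebra V S]
    [Algebra.Smooth V S] [Algebra V κ] (hV : ∀ x : κ, _root_.IsIntegral V x → ∃ v, algebraMap V κ v = x)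
    (Φ : S ⊗[V] κ ≃+* L) (F : S →+* L) (hF : ∀ s, F s = Φ (s ⊗ₜ 1)) (x : L)
    (hx : F.IsIntegralElem x) :
    ∃ s : S, F s = x := by
  obtain rfl : F = ((Φ : S ⊗[V] κ →+* L).comp (algebraMap S (S ⊗[V] κ))) := RingHom.ext hF
  change ∃ s : S, Φ (s ⊗ₜ 1) = x
  have hint : _root_.IsIntegral S (Φ.symm x) := by
    obtain ⟨p, hp, hpx⟩ := hx
    refine ⟨p, hp, ?_⟩
    apply Φ.injective
    rw [← RingEquiv.coe_toRingHom Φ, Polynomial.hom_eval₂]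
    simpa using hpx
  obtain ⟨w, hw⟩ := (TensorProduct.toIntegralClosure_bijective_of_smooth (R := V) (S := S) (B := κ)).2 ⟨_, hint⟩
  have hw' : Φ.symm x = (Algebra.TensorProduct.map (.id S S) (integralClosure V κ).val) w := congr($(hw).1).symm
  suffices ∃ s : S, (s ⊗ₜ 1) = Φ.symm x by
    obtain ⟨s, hs⟩ := this
    exact ⟨s, by rw [hs]; simp⟩
  rw [hw']
  clear hw' hw
  induction w with
  | zero => exact ⟨0, by simp⟩
  | add x y hx hy => 
    obtain ⟨a, ha⟩ := hx
    obtain ⟨b, hb⟩ := hy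
    exact ⟨a + b, by rw [map_add, add_tmul, ha, hb]⟩
  | tmul s v =>
    obtain ⟨v', hv'⟩ := hV v v.2
    refine ⟨v' • s, ?_⟩
    rw [TensorProduct.smul_tmul]; simp [Algebra.smul_def, hv']

lemma VB_closed {A B κ : Type u} [CommRing A] [CommRing B] [Algebra A B] [Algebra.Etale A B]
    [CommRing κ] [Algebra A κ] (V : Subalgebra A κ) (hV : ∀ x : κ, _root_.IsIntegral V x → x ∈ V)
    (x : B ⊗[A] κ) (hx : _root_.IsIntegral (VB B V) x) : x ∈ VB B V := by
  let Φ : (V ⊗[A] B) ⊗[V] κ ≃+* B ⊗[A] κ :=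
    (((Algebra.TensorProduct.comm V (V ⊗[A] B) κ).toRingEquiv).trans
     (Algebra.TensorProduct.cancelBaseChange A V V κ B).toRingEquiv).trans
     (Algebra.TensorProduct.comm A κ B).toRingEquiv
  have hΦ : ∀ (v : V) (b : B) (z : κ), Φ ((v ⊗ₜ b) ⊗ₜ z) = b ⊗ₜ ((v : κ) * z) := by
    intro v b z
    simp [Φ, Algebra.smul_def]
  let F : (V ⊗[A] B) →+* B ⊗[A] κ := (Algebra.TensorProduct.map (AlgHom.id B B) V.val : B ⊗[A] V →+* B ⊗[A] κ).comp
    (Algebra.TensorProduct.comm A V B).toRingEquiv.toRingHom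
  have hF : ∀ (v : V) (b : B), F (v ⊗ₜ b) = b ⊗ₜ (v : κ) := by
    intro v b
    simp [F]
  have hF' : ∀ s, F s = Φ (s ⊗ₜ 1) := by
    intro s
    induction s with
    | zero => have := hΦ 0 0 1; rw [zero_tmul, zero_tmul] at this; rw [map_zero, zero_tmul, this, zero_tmul]
    | add x y hx hy => rw [map_add, add_tmul, hx, hy]; exact (Φ.map_add' _ _).symm
    | tmul v b => rw [hF, hΦ, mul_one]
  have hΦS : ∀ s , F s ∈ VB B V := by
    intro s
    induction s with
    | zero => rw [map_zero]; exact zero_mem _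
    | add x y hx hy => rw [map_add]; exact add_mem hx hy
    | tmul v b => rw [hF]; exact ⟨b ⊗ₜ v, by simp⟩
  have hΦS' : ∀ y : VB B V, ∃ s, F s = algebraMap (VB B V) _ y := by
    rintro ⟨_, ⟨y, rfl⟩⟩
    change ∃ s, F s = Algebra.TensorProduct.map (AlgHom.id B B) V.val y
    induction y with
    | zero => exact ⟨0, by rw [map_zero, map_zero]⟩
    | add x y hx hy => 
      obtain ⟨a, ha⟩ := hx
      obtain ⟨b, hb⟩ := hy
      exact ⟨a + b, by rw [map_add, map_add, ha, hb]⟩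
    | tmul b v => exact ⟨v ⊗ₜ b, by rw [hF]; simp⟩
  obtain ⟨s, rfl⟩ := closed_aux (V := V) (S := V ⊗[A] B) (κ := κ) (fun x hx => ⟨⟨x, hV x hx⟩, rfl⟩) Φ F hF' x
    (integral_of_range _ _ hΦS' x hx)
  exact hΦS s
end

lemma lemG {X S Y T : Scheme.{u}} [AlgebraicGeometry.IsReduced X] (j : T ⟶ X) [IsDominant j] (sX : X ⟶ S) (g : Y ⟶ S)
    [IsSeparated g] (t : T ⟶ Y)
    (H : ∀ x : X, ∃ (U : Scheme.{u}) (u : U ⟶ X) (_ : IsOpenImmersion u) (φ : U ⟶ Y) (j' : T ⟶ U),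
      x ∈ Set.range u ∧ φ ≫ g = u ≫ sX ∧ j' ≫ u = j ∧ j' ≫ φ = t) :
    ∃ φ : X ⟶ Y, φ ≫ g = sX ∧ j ≫ φ = t := by
  choose U u hu φ j' h1 h2 h3 h4 using H
  let 𝒰 : X.OpenCover := Scheme.Cover.mkOfCovers X U u (fun x => ⟨x, by simpa using h1 x⟩) hu
  have key : ∀ x y : X, pullback.fst (u x) (u y) ≫ φ x = pullback.snd _ _ ≫ φ y := by
    intro x y
    let l : T ⟶ pullback (u x) (u y) := pullback.lift (j' x) (j' y) (by rw [h3, h3])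
    have hl : l ≫ (pullback.fst (u x) (u y) ≫ u x) = j := by rw [pullback.lift_fst_assoc, h3]
    haveI : IsDominant (l ≫ (pullback.fst (u x) (u y) ≫ u x)) := by rw [hl]; infer_instance
    haveI : IsDominant l := IsDominant.of_comp_of_isOpenImmersion l (pullback.fst (u x) (u y) ≫ u x)
    haveI : AlgebraicGeometry.IsReduced (pullback (u x) (u y)) :=
      isReduced_of_isOpenImmersion (pullback.fst (u x) (u y) ≫ u x)
    refine ext_of_isDominant_of_isSeparated g ?_ l ?_
    · rw [Category.assoc, Category.assoc, h2, h2, pullback.condition_assoc]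
    · rw [pullback.lift_fst_assoc, pullback.lift_snd_assoc, h4, h4]
  refine ⟨𝒰.glueMorphisms φ key, ?_, ?_⟩
  · refine Scheme.Cover.hom_ext 𝒰 _ _ fun i => ?_
    have := Scheme.Cover.ι_glueMorphisms 𝒰 φ key i
    rw [← Category.assoc]
    exact (congr($this ≫ g)).trans (h2 i)
  · by_cases hX : Nonempty X
    · obtain ⟨x⟩ := hX
      conv_lhs => rw [← h3 x]
      have := Scheme.Cover.ι_glueMorphisms 𝒰 φ key x
      rw [Category.assoc]
      exact (congr(j' x ≫ $this)).trans (h4 x)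
    · haveI : IsEmpty T := ⟨fun p => hX ⟨j p⟩⟩
      exact (isInitialOfIsEmpty (X := T)).hom_ext _ _

lemma isDominant_of_inj {R S : Type u} [CommRing R] [CommRing S] (f : R →+* S) (hf : Function.Injective f) :
    IsDominant (Spec.map (CommRingCat.ofHom f)) := by
  rw [isDominant_iff]
  refine (PrimeSpectrum.denseRange_comap_iff_ker_le_nilRadical f).mpr ?_
  rw [(RingHom.injective_iff_ker_eq_bot f).mp hf]
  exact bot_le

lemma lift_val {R F : Type u} [CommRing R] [IsDomain R] [ValuationRing R] [Field F] [Algebra R F] [IsFractionRing R F]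
    {S Y : Scheme.{u}} (g : Y ⟶ S) [IsProper g] (t : Spec (.of F) ⟶ Y) (s : Spec (.of R) ⟶ S)
    (h : t ≫ g = Spec.map (CommRingCat.ofHom (algebraMap R F)) ≫ s) :
    ∃ l : Spec (.of R) ⟶ Y, Spec.map (CommRingCat.ofHom (algebraMap R F)) ≫ l = t ∧ l ≫ g = s := by
  have hval : ValuativeCriterion.Existence g := by
    have : UniversallyClosed g := inferInstance
    rw [UniversallyClosed.eq_valuativeCriterion] at this
    exact this.1
  obtain ⟨⟨l, hl1, hl2⟩⟩ := hval ⟨R, F, t, s, ⟨h⟩⟩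
  exact ⟨l, hl1, hl2⟩

lemma s2loc {κ F D : Type u} [Field κ] [Field F] [Algebra κ F] [Algebra.IsAlgebraic κ F]
    (V : ValuationSubring κ) [CommRing D] [IsDomain D]
    [Algebra D F] [IsFractionRing D F] [IsIntegrallyClosed D]
    (hVD : ∀ v ∈ V, ∃ d, algebraMap D F d = algebraMap κ F v)
    {S Y : Scheme.{u}} (g : Y ⟶ S) [IsProper g] (t : Spec (.of F) ⟶ Y)
    (R : Type u) [CommRing R] [Algebra D R] (p : Ideal D) [p.IsPrime] [IsLocalization.AtPrime R p] :
    ∃ ρ : R →+* F, (∀ d, ρ (algebraMap D R d) = algebraMap D F d) ∧ ∀ s : Spec (.of R) ⟶ S,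
      t ≫ g = Spec.map (CommRingCat.ofHom ρ) ≫ s →
      ∃ l : Spec (.of R) ⟶ Y, Spec.map (CommRingCat.ofHom ρ) ≫ l = t ∧ l ≫ g = s := by
  have hle : p.primeCompl ≤ nonZeroDivisors D := p.primeCompl_le_nonZeroDivisors
  have hu : ∀ y : p.primeCompl, IsUnit (algebraMap D F y) := fun y =>
    IsLocalization.map_units F (⟨y.1, hle y.2⟩ : nonZeroDivisors D)
  let ρ : R →+* F := IsLocalization.lift hu
  refine ⟨ρ, fun d => IsLocalization.lift_eq hu d, fun s hs => ?_⟩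
  letI : Algebra R F := ρ.toAlgebra
  haveI : IsScalarTower D R F := IsScalarTower.of_algebraMap_eq' (IsLocalization.lift_comp hu).symm
  haveI : IsFractionRing R F :=
    IsFractionRing.isFractionRing_of_isDomain_of_isLocalization p.primeCompl R F
  haveI : IsDomain R := (IsFractionRing.injective R F).isDomain (algebraMap R F)
  haveI : IsLocalRing R := IsLocalization.AtPrime.isLocalRing R p
  haveI : IsIntegrallyClosed R := isIntegrallyClosed_of_isLocalization R _ hle
  haveI : ValuationRing R := val_of_normal (L := F) V R (fun v hv => by
    obtain ⟨d, hd⟩ := hVD v hv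
    exact ⟨algebraMap D R d, by rw [← IsScalarTower.algebraMap_apply, hd]⟩)
  exact lift_val g t s hs

lemma s2dom {κ F D : Type u} [Field κ] [Field F] [Algebra κ F] [Algebra.IsAlgebraic κ F]
    (V : ValuationSubring κ) [CommRing D] [IsDomain D]
    [Algebra D F] [IsFractionRing D F] [IsIntegrallyClosed D]
    (hVD : ∀ v ∈ V, ∃ d, algebraMap D F d = algebraMap κ F v)
    {S Y : Scheme.{u}} (sX : Spec (.of D) ⟶ S) (g : Y ⟶ S) [IsProper g] (t : Spec (.of F) ⟶ Y)
    (ht : t ≫ g = Spec.map (CommRingCat.ofHom (algebraMap D F)) ≫ sX) :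
    ∃ φ : Spec (.of D) ⟶ Y, φ ≫ g = sX ∧ Spec.map (CommRingCat.ofHom (algebraMap D F)) ≫ φ = t := by
  haveI := isDominant_of_inj (algebraMap D F) (IsFractionRing.injective D F)
  refine lemG _ sX g t fun x => ?_
  let p : Ideal D := PrimeSpectrum.asIdeal (R := D) x
  haveI : p.IsPrime := PrimeSpectrum.isPrime (R := D) x
  let k : Algebra D ((Spec (.of D)).presheaf.stalk x) := StructureSheaf.stalkAlgebra D x
  have hloc : IsLocalization.AtPrime ((Spec (.of D)).presheaf.stalk x) p :=
    StructureSheaf.IsLocalization.to_stalk D x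
  obtain ⟨ρ, hρ, H⟩ := s2loc V hVD g t ((Spec (.of D)).presheaf.stalk x) p
  have hcomp : Spec.map (CommRingCat.ofHom ρ) ≫ (Spec (.of D)).fromSpecStalk x =
      Spec.map (CommRingCat.ofHom (algebraMap D F)) := by
    rw [Spec.fromSpecStalk_eq, ← Spec.map_comp]
    congr 1
    ext a
    exact hρ a
  obtain ⟨l, hl1, hl2⟩ := H ((Spec (.of D)).fromSpecStalk x ≫ sX) (by rw [ht, ← hcomp, Category.assoc])
  obtain ⟨U, hxU, f, hf1, hf2⟩ := spread_out_of_isGermInjective' sX g (x := x) l hl2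
  refine ⟨U, U.ι, inferInstance, f, Spec.map (CommRingCat.ofHom ρ) ≫ U.fromSpecStalkOfMem x hxU,
    by simpa using hxU, hf2, ?_, ?_⟩
  · rw [Category.assoc, Scheme.Opens.fromSpecStalkOfMem_ι, hcomp]
  · rw [Category.assoc, ← hf1]; exact hl1

lemma specProd {ι : Type u} [Finite ι] (R : CommRingCat.{u}) (D : ι → CommRingCat.{u}) (f : ∀ i, R ⟶ D i)
    (hf : Function.Bijective (fun (r : R) i => f i r)) : IsIso (Sigma.desc fun i => Spec.map (f i)) := by
  let e : R ⟶ CommRingCat.of (∀ i, D i) := CommRingCat.ofHom (RingHom.pi fun i => (f i).hom)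
  haveI : IsIso e := (ConcreteCategory.isIso_iff_bijective e).mpr hf
  have : (Sigma.desc fun i => Spec.map (f i)) = sigmaSpec D ≫ Spec.map e := by
    refine Sigma.hom_ext _ _ fun i => ?_
    rw [Sigma.ι_desc, ι_sigmaSpec_assoc, ← Spec.map_comp]
    rfl
  rw [this]; infer_instance

lemma specProd_ext {ι : Type u} [Finite ι] (R : CommRingCat.{u}) (D : ι → CommRingCat.{u}) (f : ∀ i, R ⟶ D i)
    (hf : Function.Bijective (fun (r : R) i => f i r)) {Y : Scheme.{u}} (a b : Spec R ⟶ Y)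
    (h : ∀ i, Spec.map (f i) ≫ a = Spec.map (f i) ≫ b) : a = b := by
  haveI := specProd R D f hf
  rw [← cancel_epi (Sigma.desc fun i => Spec.map (f i))]
  refine Sigma.hom_ext _ _ fun i => ?_
  rw [Sigma.ι_desc_assoc, Sigma.ι_desc_assoc, h]

lemma specProd_exists {ι : Type u} [Finite ι] (R : CommRingCat.{u}) (D : ι → CommRingCat.{u}) (f : ∀ i, R ⟶ D i)
    (hf : Function.Bijective (fun (r : R) i => f i r)) {Y : Scheme.{u}} (a : ∀ i, Spec (D i) ⟶ Y) :
    ∃ φ : Spec R ⟶ Y, ∀ i, Spec.map (f i) ≫ φ = a i := by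
  haveI := specProd R D f hf
  refine ⟨inv (Sigma.desc fun i => Spec.map (f i)) ≫ Sigma.desc a, fun i => ?_⟩
  have : Spec.map (f i) = Sigma.ι _ i ≫ Sigma.desc fun i => Spec.map (f i) := by rw [Sigma.ι_desc]
  rw [this, Category.assoc, IsIso.hom_inv_id_assoc, Sigma.ι_desc]

lemma artin_crt (L : Type u) [CommRing L] [IsArtinianRing L] [IsReduced L] :
    Function.Bijective (fun (r : L) (m : MaximalSpectrum L) => Ideal.Quotient.mk m.asIdeal r) :=
  (IsArtinianRing.equivPi L).bijective

lemma fieldD {κ F : Type u} [Field κ] [Field F] [Algebra κ F] [Algebra.IsAlgebraic κ F]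
    (V : ValuationSubring κ) (D : Subring F) (hD : ∀ x : F, IsIntegral D x → x ∈ D)
    (hVD : ∀ v ∈ V, algebraMap κ F v ∈ D) : IsFractionRing D F ∧ IsIntegrallyClosed D := by
  have hic : IsIntegralClosure D D F := ⟨Subtype.val_injective, fun {x} => ⟨fun h => ⟨⟨x, hD x h⟩, rfl⟩,
    by rintro ⟨y, rfl⟩; exact isIntegral_algebraMap⟩⟩
  let φ : V →+* D := ((algebraMap κ F).comp V.subtype).codRestrict D (fun v => hVD v v.2)
  letI : Algebra V D := φ.toAlgebra
  letI : Algebra V F := ((algebraMap κ F).comp V.subtype).toAlgebra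
  haveI : IsScalarTower V κ F := IsScalarTower.of_algebraMap_eq' rfl
  haveI : IsScalarTower V D F := IsScalarTower.of_algebraMap_eq' rfl
  have hinj : Function.Injective (algebraMap V D) := by
    intro a b h
    have := congrArg Subtype.val h
    exact Subtype.ext ((algebraMap κ F).injective this)
  haveI : Algebra.IsAlgebraic D F := ⟨fun x => by
    have h := Algebra.IsAlgebraic.isAlgebraic (R := κ) x
    have h2 : IsAlgebraic V x := (IsFractionRing.isAlgebraic_iff V κ F).mpr h
    exact h2.extendScalars hinj⟩
  have hfr : IsFractionRing D F := IsIntegralClosure.isFractionRing_of_algebraic D D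
    (fun x hx => Subtype.ext hx)
  exact ⟨hfr, (isIntegrallyClosed_iff_isIntegralClosure (K := F)).mpr hic⟩

open Polynomial in
lemma imageD {L : Type u} [CommRing L] [IsArtinianRing L] [IsReduced L] (W : Subring L)
    (hW : ∀ x : L, IsIntegral W x → x ∈ W) (m : MaximalSpectrum L) (x : L ⧸ m.asIdeal)
    (hx : IsIntegral (W.map (Ideal.Quotient.mk m.asIdeal)) x) : x ∈ W.map (Ideal.Quotient.mk m.asIdeal) := by
  classical
  obtain ⟨y, hy⟩ := (artin_crt L).2 (Pi.single m x)
  have hym : Ideal.Quotient.mk m.asIdeal y = x := by simpa using congrFun hy m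
  have hyn : ∀ n, n ≠ m → Ideal.Quotient.mk n.asIdeal y = 0 := fun n hn => by simpa [hn] using congrFun hy n
  have h2 : ((Ideal.Quotient.mk m.asIdeal).comp W.subtype).IsIntegralElem x :=
    integral_of_range (algebraMap (W.map (Ideal.Quotient.mk m.asIdeal)) (L ⧸ m.asIdeal)) _
      (by rintro ⟨_, w, hw, rfl⟩; exact ⟨⟨w, hw⟩, rfl⟩) x hx
  obtain ⟨q, hq, hqx⟩ := h2
  refine ⟨y, hW y ⟨X * q, monic_X.mul hq, ?_⟩, hym⟩
  apply (artin_crt L).1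
  funext n
  rw [eval₂_mul, eval₂_X]
  simp only [map_mul, map_zero]
  by_cases hn : n = m
  · subst hn
    have : Ideal.Quotient.mk n.asIdeal (eval₂ (algebraMap W L) y q) = 0 := by
      rw [hom_eval₂, hym]; exact hqx
    rw [this, mul_zero]
  · rw [hyn n hn, zero_mul]

lemma prodW {L : Type u} [CommRing L] [IsArtinianRing L] [IsReduced L] (W : Subring L)
    (hW : ∀ x : L, IsIntegral W x → x ∈ W) :
    Function.Bijective (fun (w : W) (m : MaximalSpectrum L) =>
      (⟨Ideal.Quotient.mk m.asIdeal w, w, w.2, rfl⟩ : W.map (Ideal.Quotient.mk m.asIdeal))) := by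
  classical
  constructor
  · intro a b h
    apply Subtype.ext
    apply (artin_crt L).1
    funext m
    exact congrArg Subtype.val (congrFun h m)
  · intro d
    obtain ⟨y, hy⟩ := (artin_crt L).2 (fun m => (d m).1)
    have hy' : ∀ m : MaximalSpectrum L, Ideal.Quotient.mk m.asIdeal y = d m := fun m => congrFun hy m
    have he : ∀ m : MaximalSpectrum L, ∃ e ∈ W, ∀ n : MaximalSpectrum L,
        Ideal.Quotient.mk n.asIdeal e = if n = m then 1 else 0 := by
      intro m
      obtain ⟨e, he⟩ := (artin_crt L).2 (fun n => if n = m then 1 else 0)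
      have he' : ∀ n : MaximalSpectrum L, Ideal.Quotient.mk n.asIdeal e = if n = m then 1 else 0 :=
        fun n => congrFun he n
      have hid : e * e = e := by
        apply (artin_crt L).1
        funext n
        simp only [map_mul, he']
        split_ifs <;> simp
      refine ⟨e, hW e ⟨Polynomial.X ^ 2 - Polynomial.X, Polynomial.monic_X_pow_sub (Polynomial.degree_X_le.trans_lt (by norm_num)), ?_⟩, he'⟩
      simp [pow_two, hid]
    choose e heW he using he
    choose w hwW hw using fun m => (d m).2
    cases nonempty_fintype (MaximalSpectrum L)
    refine ⟨⟨∑ m, e m * w m, sum_mem fun m _ => mul_mem (heW m) (hwW m)⟩, ?_⟩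
    funext n
    apply Subtype.ext
    simp [map_sum, he, hw]

lemma glueProd {ι : Type u} [Finite ι] {W L : Type u} [CommRing W] [CommRing L] (D F : ι → Type u)
    [∀ i, CommRing (D i)] [∀ i, CommRing (F i)] (f : ∀ i, W →+* D i) (q : ∀ i, L →+* F i)
    (c : ∀ i, D i →+* F i) (w : W →+* L) (hc : ∀ i, (c i).comp (f i) = (q i).comp w)
    (hf : Function.Bijective (fun (x : W) i => f i x)) (hq : Function.Bijective (fun (x : L) i => q i x))
    {S Y : Scheme.{u}} (sX : Spec (.of W) ⟶ S) (g : Y ⟶ S) (t : Spec (.of L) ⟶ Y)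
    (φ : ∀ i, Spec (.of (D i)) ⟶ Y) (h1 : ∀ i, φ i ≫ g = Spec.map (CommRingCat.ofHom (f i)) ≫ sX)
    (h2 : ∀ i, Spec.map (CommRingCat.ofHom (c i)) ≫ φ i = Spec.map (CommRingCat.ofHom (q i)) ≫ t) :
    ∃ φ : Spec (.of W) ⟶ Y, φ ≫ g = sX ∧ Spec.map (CommRingCat.ofHom w) ≫ φ = t := by
  obtain ⟨Φ, hΦ⟩ := specProd_exists (CommRingCat.of W) (fun i => CommRingCat.of (D i))
    (fun i => CommRingCat.ofHom (f i)) hf φ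
  refine ⟨Φ, ?_, ?_⟩
  · refine specProd_ext (CommRingCat.of W) _ (fun m => CommRingCat.ofHom (f m)) hf _ _ fun m => ?_
    rw [← Category.assoc, hΦ, h1]
  · refine specProd_ext (CommRingCat.of L) _ (fun m => CommRingCat.ofHom (q m)) hq _ _ fun m => ?_
    rw [← h2, ← hΦ, ← Spec.map_comp_assoc, ← Spec.map_comp_assoc, ← CommRingCat.ofHom_comp,
      ← CommRingCat.ofHom_comp, hc]

lemma s2prod {κ L : Type u} [Field κ] [CommRing L] [Algebra κ L] [Module.Finite κ L] [IsReduced L]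
    (V : ValuationSubring κ) (W : Subring L) (hW : ∀ x : L, IsIntegral W x → x ∈ W)
    (hVD : ∀ v ∈ V, algebraMap κ L v ∈ W)
    {S Y : Scheme.{u}} (sX : Spec (.of W) ⟶ S) (g : Y ⟶ S) [IsProper g] (t : Spec (.of L) ⟶ Y)
    (ht : t ≫ g = Spec.map (CommRingCat.ofHom W.subtype) ≫ sX) :
    ∃ φ : Spec (.of W) ⟶ Y, φ ≫ g = sX ∧ Spec.map (CommRingCat.ofHom W.subtype) ≫ φ = t := by
  haveI : IsArtinianRing L := IsArtinianRing.of_finite κ L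
  let D : MaximalSpectrum L → Type u := fun m => W.map (Ideal.Quotient.mk m.asIdeal)
  let f : ∀ m : MaximalSpectrum L, W →+* W.map (Ideal.Quotient.mk m.asIdeal) := fun m =>
    ((Ideal.Quotient.mk m.asIdeal).comp W.subtype).codRestrict _ (fun w => ⟨w, w.2, rfl⟩)
  have key : ∀ m : MaximalSpectrum L, ∃ φ : Spec (.of (W.map (Ideal.Quotient.mk m.asIdeal))) ⟶ Y,
      φ ≫ g = Spec.map (CommRingCat.ofHom (f m)) ≫ sX ∧
      Spec.map (CommRingCat.ofHom (W.map (Ideal.Quotient.mk m.asIdeal)).subtype) ≫ φ =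
        Spec.map (CommRingCat.ofHom (Ideal.Quotient.mk m.asIdeal)) ≫ t := by
    intro m
    letI : Field (L ⧸ m.asIdeal) := Ideal.Quotient.field m.asIdeal
    haveI : Algebra.IsAlgebraic κ (L ⧸ m.asIdeal) := inferInstance
    have hVD' : ∀ v ∈ V, algebraMap κ (L ⧸ m.asIdeal) v ∈ W.map (Ideal.Quotient.mk m.asIdeal) :=
      fun v hv => ⟨algebraMap κ L v, hVD v hv, rfl⟩
    obtain ⟨h1, h2⟩ := fieldD V (W.map (Ideal.Quotient.mk m.asIdeal)) (imageD W hW m) hVD'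
    refine s2dom V (fun v hv => ⟨⟨_, hVD' v hv⟩, rfl⟩) _ g _ ?_
    rw [Category.assoc, ht, ← Spec.map_comp_assoc, ← Spec.map_comp_assoc]
    rfl
  choose φ h1 h2 using key
  exact glueProd _ (fun m : MaximalSpectrum L => L ⧸ m.asIdeal) f (fun m => Ideal.Quotient.mk m.asIdeal)
    (fun m => (W.map (Ideal.Quotient.mk m.asIdeal)).subtype) W.subtype (fun m => rfl) (prodW W hW)
    (artin_crt L) sX g t φ h1 h2

noncomputable def s3F {B L I : Type u} [CommRing B] [CommRing L] [Algebra B L] [SemilatticeSup I]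
    (R : I → Subalgebra B L) (hR : Monotone R) : I ⥤ CommRingCat.{u} where
  obj i := CommRingCat.of (R i)
  map h := CommRingCat.ofHom (Subalgebra.inclusion (hR (leOfHom h))).toRingHom
  map_id _ := rfl
  map_comp _ _ := rfl

noncomputable def s3c {B L I : Type u} [CommRing B] [CommRing L] [Algebra B L] [SemilatticeSup I]
    (R : I → Subalgebra B L) (hR : Monotone R) (W : Subalgebra B L) (hRW : ∀ i, R i ≤ W) :
    Cocone (s3F R hR) where
  pt := CommRingCat.of W
  ι := { app := fun i => CommRingCat.ofHom (Subalgebra.inclusion (hRW i)).toRingHom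
         naturality := fun _ _ _ => rfl }

noncomputable def s3colim {B L I : Type u} [CommRing B] [CommRing L] [Algebra B L] [SemilatticeSup I] [Nonempty I]
    (R : I → Subalgebra B L) (hR : Monotone R) (W : Subalgebra B L) (hRW : ∀ i, R i ≤ W)
    (hW : ∀ x ∈ W, ∃ i, x ∈ R i) : IsColimit (s3c R hR W hRW) := by
  haveI : ReflectsColimitsOfShape I (forget CommRingCat.{u}) :=
    reflectsColimitsOfShape_of_reflectsIsomorphisms
  refine isColimitOfReflects (forget CommRingCat) ?_
  refine Types.FilteredColimit.isColimitOf _ _ ?_ ?_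
  · rintro ⟨x, hx⟩
    obtain ⟨i, hi⟩ := hW x hx
    exact ⟨i, ⟨x, hi⟩, rfl⟩
  · intro i j x y h
    refine ⟨i ⊔ j, homOfLE le_sup_left, homOfLE le_sup_right, ?_⟩
    apply Subtype.ext
    have h' : (Subalgebra.inclusion (hRW i)) x = Subalgebra.inclusion (hRW j) y := h
    have h'' := congrArg (Subtype.val : W → L) h'
    exact h''

lemma s3 {B L I : Type u} [CommRing B] [CommRing L] [Algebra B L] [SemilatticeSup I] [Nonempty I]
    (R : I → Subalgebra B L) (hR : Monotone R) (W : Subalgebra B L) (hRW : ∀ i, R i ≤ W)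
    (hW : ∀ x ∈ W, ∃ i, x ∈ R i) {Y : Scheme.{u}} (g : Y ⟶ Spec (.of B)) [LocallyOfFinitePresentation g]
    (a : Spec (.of W) ⟶ Y) (ha : a ≫ g = Spec.map (CommRingCat.ofHom (algebraMap B W))) :
    ∃ (i : I) (b : Spec (.of (R i)) ⟶ Y),
      Spec.map (CommRingCat.ofHom (Subalgebra.inclusion (hRW i)).toRingHom) ≫ b = a ∧
      b ≫ g = Spec.map (CommRingCat.ofHom (algebraMap B (R i))) := by
  let D : Iᵒᵖ ⥤ Scheme.{u} := (s3F R hR).op ⋙ Scheme.Spec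
  let c : Cone D := Scheme.Spec.mapCone (s3c R hR W hRW).op
  let hc : IsLimit c := isLimitOfPreserves Scheme.Spec (s3colim R hR W hRW hW).op
  let t : D ⟶ (Functor.const _).obj (Spec (.of B)) :=
    { app := fun i => Spec.map (CommRingCat.ofHom (algebraMap B (R i.unop)))
      naturality := by
        intro i j h
        refine (Spec.map_comp _ _).symm.trans ?_
        exact (Category.comp_id _).symm }
  haveI : ∀ {i j : Iᵒᵖ} (h : i ⟶ j), IsAffineHom (D.map h) := fun {i j} h =>
    inferInstanceAs (IsAffineHom (Spec.map ((s3F R hR).map h.unop)))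
  haveI : ∀ i, CompactSpace (D.obj i) := fun i => inferInstanceAs (CompactSpace (Spec ((s3F R hR).obj i.unop)))
  haveI : ∀ i, QuasiSeparatedSpace (D.obj i) := fun i =>
    inferInstanceAs (QuasiSeparatedSpace (Spec ((s3F R hR).obj i.unop)))
  obtain ⟨i, b, h1, h2⟩ := Scheme.exists_π_app_comp_eq_of_locallyOfFinitePresentation D t g c hc a (by
    ext i : 2
    refine Eq.trans ?_ ha.symm
    exact (Spec.map_comp _ _).symm)
  exact ⟨i.unop, b, h1, h2⟩

open TensorProduct in
lemma etale_facts (A B κ : Type u) [CommRing A] [CommRing B] [Algebra A B] [Algebra.Etale A B] [Field κ] [Algebra A κ] :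
    _root_.IsReduced (B ⊗[A] κ) ∧ (Algebra.TensorProduct.includeRight : κ →ₐ[A] B ⊗[A] κ).toRingHom.Finite := by
  have hE : Algebra.Etale κ (κ ⊗[A] B) := inferInstance
  have hfin : Module.Finite κ (κ ⊗[A] B) := Algebra.FormallyUnramified.finite_of_free κ _
  have hred : _root_.IsReduced (κ ⊗[A] B) := Algebra.FormallyUnramified.isReduced_of_field κ _
  let e := Algebra.TensorProduct.comm A κ B
  refine ⟨isReduced_of_injective e.symm.toRingEquiv.toRingHom e.symm.injective, ?_⟩
  have h1 : (algebraMap κ (κ ⊗[A] B)).Finite := RingHom.finite_algebraMap.mpr hfin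
  have h2 : (e.toRingEquiv.toRingHom).Finite := RingHom.Finite.of_surjective _ e.surjective
  have h3 := h2.comp h1
  convert h3 using 1
  ext x
  simp [e]

def el {κ : Type u} [Field κ] (ε : κ → Bool) (z : κ) : κ := if ε z then z else z⁻¹

def Veps (A : Type u) {κ : Type u} [CommRing A] [Field κ] [Algebra A κ] (ε : κ → Bool) : Subalgebra A κ :=
  Algebra.adjoin A (Set.range (el ε))

lemma Veps_or (A : Type u) {κ : Type u} [CommRing A] [Field κ] [Algebra A κ] (ε : κ → Bool) (x : κ) :
    x ∈ Veps A ε ∨ x⁻¹ ∈ Veps A ε := by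
  have h : el ε x ∈ Veps A ε := Algebra.subset_adjoin ⟨x, rfl⟩
  unfold el at h
  split_ifs at h
  · exact Or.inl h
  · exact Or.inr h

def VepsVal (A : Type u) {κ : Type u} [CommRing A] [Field κ] [Algebra A κ] (ε : κ → Bool) : ValuationSubring κ :=
  { (Veps A ε).toSubring with mem_or_inv_mem' := Veps_or A ε }

lemma Veps_closed (A : Type u) {κ : Type u} [CommRing A] [Field κ] [Algebra A κ] (ε : κ → Bool) (x : κ)
    (hx : _root_.IsIntegral (Veps A ε) x) : x ∈ Veps A ε := by
  have h2 : _root_.IsIntegral (VepsVal A ε) x := hx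
  obtain ⟨y, hy⟩ := (IsIntegrallyClosed.isIntegral_iff (R := VepsVal A ε) (K := κ)).mp h2
  rw [← hy]
  exact y.2

open TensorProduct in
noncomputable def Reps {A : Type u} (B : Type u) {κ : Type u} [CommRing A] [CommRing B] [Algebra A B] [Field κ] [Algebra A κ]
    (ε : κ → Bool) (E : Finset κ) : Subalgebra B (B ⊗[A] κ) :=
  Algebra.adjoin B ((fun z => (1 : B) ⊗ₜ[A] el ε z) '' E)

open TensorProduct in
lemma Reps_mono {A : Type u} (B : Type u) {κ : Type u} [CommRing A] [CommRing B] [Algebra A B] [Field κ] [Algebra A κ]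
    (ε : κ → Bool) : Monotone (Reps (A := A) B ε) := fun _ _ h =>
  Algebra.adjoin_mono (Set.image_mono (by exact_mod_cast h))

open TensorProduct in
lemma Reps_le {A : Type u} (B : Type u) {κ : Type u} [CommRing A] [CommRing B] [Algebra A B] [Field κ] [Algebra A κ]
    (ε : κ → Bool) (E : Finset κ) : Reps (A := A) B ε E ≤ VB B (Veps A ε) := by
  refine Algebra.adjoin_le ?_
  rintro _ ⟨z, _, rfl⟩
  exact ⟨1 ⊗ₜ ⟨el ε z, Algebra.subset_adjoin ⟨z, rfl⟩⟩, by simp⟩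

open TensorProduct in
lemma Reps_union {A : Type u} (B : Type u) {κ : Type u} [CommRing A] [CommRing B] [Algebra A B] [Field κ] [Algebra A κ]
    (ε : κ → Bool) (x : B ⊗[A] κ) (hx : x ∈ VB B (Veps A ε)) : ∃ E, x ∈ Reps (A := A) B ε E := by
  classical
  have hd : Directed (· ≤ ·) (Reps (A := A) B ε) := (Reps_mono B ε).directed_le
  have hmem : ∀ x, x ∈ (⨆ E, Reps (A := A) B ε E) ↔ ∃ E, x ∈ Reps (A := A) B ε E := by
    intro x
    rw [← SetLike.mem_coe, Subalgebra.coe_iSup_of_directed hd]; simp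
  rw [← hmem]
  have h1 : ∀ v ∈ Veps A ε, (1 : B) ⊗ₜ[A] v ∈ ⨆ E, Reps (A := A) B ε E := by
    intro v hv
    have : Veps A ε ≤ ((⨆ E, Reps (A := A) B ε E).restrictScalars A).comap
        (Algebra.TensorProduct.includeRight : κ →ₐ[A] B ⊗[A] κ) := by
      refine Algebra.adjoin_le ?_
      rintro _ ⟨z, rfl⟩
      change (1 : B) ⊗ₜ[A] el ε z ∈ ⨆ E, Reps (A := A) B ε E
      rw [hmem]
      exact ⟨{z}, Algebra.subset_adjoin ⟨z, by simp, rfl⟩⟩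
    exact this hv
  obtain ⟨y, rfl⟩ := hx
  induction y with
  | zero => simp
  | add a b ha hb => rw [map_add]; exact add_mem ha hb
  | tmul b v =>
    have : (Algebra.TensorProduct.map (AlgHom.id B B) (Veps A ε).val) (b ⊗ₜ[A] v) = b • ((1 : B) ⊗ₜ[A] v.1) := by
      simp [TensorProduct.smul_tmul']
    have h2 := Subalgebra.smul_mem _ (h1 v v.2) b
    rw [← this] at h2
    exact h2

open TensorProduct in
/-- the extension property for a subalgebra -/
def Qext {A B κ : Type u} [CommRing A] [CommRing B] [Algebra A B] [Field κ] [Algebra A κ] {Y : Scheme.{u}}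
    (g : Y ⟶ Spec (.of B)) (t : Spec (.of (B ⊗[A] κ)) ⟶ Y) (R : Subalgebra B (B ⊗[A] κ)) : Prop :=
  ∃ b : Spec (.of R) ⟶ Y, b ≫ g = Spec.map (CommRingCat.ofHom (algebraMap B R)) ∧
    Spec.map (CommRingCat.ofHom R.val.toRingHom) ≫ b = t

open TensorProduct in
lemma Qext_mono {A B κ : Type u} [CommRing A] [CommRing B] [Algebra A B] [Field κ] [Algebra A κ] {Y : Scheme.{u}}
    (g : Y ⟶ Spec (.of B)) (t : Spec (.of (B ⊗[A] κ)) ⟶ Y) (R R' : Subalgebra B (B ⊗[A] κ)) (h : R ≤ R')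
    (hR : Qext g t R) : Qext g t R' := by
  obtain ⟨b, h1, h2⟩ := hR
  refine ⟨Spec.map (CommRingCat.ofHom (Subalgebra.inclusion h).toRingHom) ≫ b, ?_, ?_⟩
  · rw [Category.assoc, h1, ← Spec.map_comp]; rfl
  · rw [← h2, ← Spec.map_comp_assoc]; rfl

open TensorProduct in
lemma s4eps {A B κ : Type u} [CommRing A] [CommRing B] [Algebra A B] [Algebra.Etale A B] [Field κ] [Algebra A κ]
    {Y : Scheme.{u}} (g : Y ⟶ Spec (.of B)) [IsProper g] [LocallyOfFinitePresentation g]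
    (t : Spec (.of (B ⊗[A] κ)) ⟶ Y)
    (ht : t ≫ g = Spec.map (CommRingCat.ofHom (algebraMap B (B ⊗[A] κ)))) (ε : κ → Bool) :
    ∃ E, Qext g t (Reps B ε E) := by
  obtain ⟨hred, hfin⟩ := etale_facts A B κ
  letI : Algebra κ (B ⊗[A] κ) := (Algebra.TensorProduct.includeRight : κ →ₐ[A] B ⊗[A] κ).toRingHom.toAlgebra
  haveI : Module.Finite κ (B ⊗[A] κ) := hfin
  obtain ⟨φ, h1, h2⟩ := s2prod (VepsVal A ε) (VB B (Veps A ε)).toSubring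
    (VB_closed (Veps A ε) (Veps_closed A ε)) (fun v hv => ⟨1 ⊗ₜ ⟨v, hv⟩, by simp; rfl⟩)
    (Spec.map (CommRingCat.ofHom (algebraMap B (VB B (Veps A ε))))) g t
    (by rw [ht]; refine Eq.trans ?_ (Spec.map_comp _ _); rfl)
  classical
  obtain ⟨E, b, h3, h4⟩ := s3 (Reps (A := A) B ε) (Reps_mono B ε) _ (Reps_le B ε) (Reps_union B ε) g φ h1
  refine ⟨E, b, h4, ?_⟩
  rw [← h2, ← h3]
  refine Eq.trans ?_ (Spec.map_comp_assoc _ _ _)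
  rfl

open TensorProduct in
lemma s4 {A B κ : Type u} [CommRing A] [CommRing B] [Algebra A B] [Algebra.Etale A B] [Field κ] [Algebra A κ]
    {Y : Scheme.{u}} (g : Y ⟶ Spec (.of B)) [IsProper g] [LocallyOfFinitePresentation g]
    (t : Spec (.of (B ⊗[A] κ)) ⟶ Y)
    (ht : t ≫ g = Spec.map (CommRingCat.ofHom (algebraMap B (B ⊗[A] κ)))) :
    ∃ E : Finset κ, ∀ ε, Qext g t (Reps B ε E) := by
  classical
  choose E hE using s4eps g t ht
  have hopen : ∀ ε : κ → Bool, IsOpen {ε' : κ → Bool | ∀ z ∈ E ε, ε' z = ε z} := by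
    intro ε
    have : {ε' : κ → Bool | ∀ z ∈ E ε, ε' z = ε z} = ⋂ z ∈ E ε, {ε' | ε' z = ε z} := by ext; simp
    rw [this]
    exact isOpen_biInter_finset fun z _ => by
      have h1 : IsOpen ((fun p : κ → Bool => p z) ⁻¹' {ε z}) :=
        IsOpen.preimage (continuous_apply z) (isOpen_discrete ({ε z} : Set Bool))
      exact h1
  obtain ⟨s, hs⟩ := isCompact_univ.elim_finite_subcover _ hopen
    (fun ε _ => Set.mem_iUnion.mpr ⟨ε, fun z _ => rfl⟩)
  refine ⟨s.biUnion E, fun ε => ?_⟩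
  obtain ⟨ε₀, h0, h1⟩ := Set.mem_iUnion₂.mp (hs (Set.mem_univ ε))
  refine Qext_mono g t _ _ ?_ (hE ε₀)
  refine Algebra.adjoin_mono ?_
  rintro _ ⟨z, hz, rfl⟩
  refine ⟨z, ?_, ?_⟩
  · exact Finset.mem_biUnion.mpr ⟨ε₀, h0, hz⟩
  · have := h1 z hz
    simp only [el, this]

def SecAt {κ : Type u} [Field κ] {U : Scheme.{u}} (i : Spec (.of κ) ⟶ U) (z : κ) : Prop :=
  ∃ s : Γ(U, ⊤), (Scheme.ΓSpecIso (.of κ)).hom (i.appTop s) = z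

lemma SecAt.comp {κ : Type u} [Field κ] {U V : Scheme.{u}} (i : Spec (.of κ) ⟶ U) (v : U ⟶ V) (z : κ)
    (h : SecAt (i ≫ v) z) : SecAt i z := by
  obtain ⟨s, hs⟩ := h
  refine ⟨v.appTop s, ?_⟩
  rw [← hs, Scheme.Hom.comp_appTop]
  rfl

lemma SecAt.spec {κ R : Type u} [Field κ] [CommRing R] (f : R →+* κ) (r : R) (z : κ) (h : f r = z) :
    SecAt (Spec.map (CommRingCat.ofHom f)) z := by
  refine ⟨(Scheme.ΓSpecIso (.of R)).inv r, ?_⟩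
  have h1 := Scheme.ΓSpecIso_inv_naturality (CommRingCat.ofHom f)
  have h2 := congr($h1 r)
  have h3 := congr((Scheme.ΓSpecIso (.of κ)).hom $h2)
  refine h3.symm.trans ?_
  have h4 := congr($((Scheme.ΓSpecIso (.of κ)).inv_hom_id) (f r))
  exact h4.trans h

def IsGoodP {A κ : Type u} [CommRing A] [Field κ] [Algebra A κ] {P : Scheme.{u}} (p : P ⟶ Spec (.of A))
    (i : Spec (.of κ) ⟶ P) (E : Set κ) : Prop :=
  i ≫ p = Spec.map (CommRingCat.ofHom (algebraMap A κ)) ∧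
  ∀ x : P, ∃ (U : Scheme.{u}) (u : U ⟶ P) (_ : IsOpenImmersion u) (i' : Spec (.of κ) ⟶ U),
    x ∈ Set.range u ∧ i' ≫ u = i ∧ ∀ z ∈ E, SecAt i' z ∨ SecAt i' z⁻¹

section
open HomogeneousLocalization
variable {S κ : Type u} [CommRing S] [Field κ] {σ : Type u} [SetLike σ S] [AddSubgroupClass σ S]
  (𝒜 : ℕ → σ) [GradedRing 𝒜]
noncomputable def psi (φ : S →+* κ) (f : S) (hf : φ f ≠ 0) : Away 𝒜 f →+* κ :=
  (Localization.awayLift φ f (isUnit_iff_ne_zero.mpr hf)).comp (algebraMap (Away 𝒜 f) (Localization.Away f))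

lemma psi_mk (φ : S →+* κ) (f : S) (hf : φ f ≠ 0) {d : ℕ} (hd : f ∈ 𝒜 d) (n : ℕ) (x : S) (hx : x ∈ 𝒜 (n • d)) :
    psi 𝒜 φ f hf (Away.mk 𝒜 hd n x hx) = φ x / φ f ^ n := by
  rw [psi, RingHom.comp_apply, HomogeneousLocalization.algebraMap_apply, Away.val_mk,
    Localization.awayLift_mk (hv := mul_inv_cancel₀ hf)]
  · simp [div_eq_mul_inv]

lemma psi_awayMap (φ : S →+* κ) (f g x : S) (hx : x = f * g) (hf : φ f ≠ 0) (hxx : φ x ≠ 0) {d : ℕ} (hg : g ∈ 𝒜 d) :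
    (psi 𝒜 φ x hxx).comp (awayMap 𝒜 hg hx) = psi 𝒜 φ f hf := by
  ext a
  rw [psi, psi]
  simp only [RingHom.comp_apply, HomogeneousLocalization.algebraMap_apply]
  rw [val_awayMap]
  simp only [← RingHom.comp_apply]
  congr 1
  apply IsLocalization.ringHom_ext (Submonoid.powers f)
  ext s
  simp

lemma psi_fromZero (φ : S →+* κ) (f : S) (hf : φ f ≠ 0) (a : 𝒜 0) :
    psi 𝒜 φ f hf (fromZeroRingHom 𝒜 _ a) = φ a := by
  have : (fromZeroRingHom 𝒜 (Submonoid.powers f) a).val = algebraMap S _ (a : S) := by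
    rfl
  rw [psi, RingHom.comp_apply, HomogeneousLocalization.algebraMap_apply, this]
  simp
end

open HomogeneousLocalization in
lemma s5p0 (A κ S : Type u) [CommRing A] [Field κ] [Algebra A κ] [CommRing S] [Algebra A S]
    (𝒜 : ℕ → Submodule A S) [GradedAlgebra 𝒜] (z : κ) (hz : z ≠ 0) (φ : S →ₐ[A] κ)
    (x0 x1 : S) (hd0 : x0 ∈ 𝒜 1) (hd1 : x1 ∈ 𝒜 1) (hφ0 : φ x0 = 1) (hφ1 : φ x1 = z)
    (h0 : ∀ s ∈ 𝒜 0, ∃ a, algebraMap A S a = s) (hadj : Algebra.adjoin A (Set.range ![x0, x1]) = ⊤) :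
    ∃ (P : Scheme.{u}) (p : P ⟶ Spec (.of A)) (_ : IsProper p) (i : Spec (.of κ) ⟶ P),
      IsGoodP p i {z} := by
  let a0 : A →+* 𝒜 0 := algebraMap A (𝒜 0)
  have ha0 : Function.Surjective a0 := by
    rintro ⟨x, hx⟩
    obtain ⟨y, hy⟩ := h0 x hx
    exact ⟨y, Subtype.ext hy⟩
  have hadj' : Algebra.adjoin (𝒜 0) (Set.range ![x0, x1]) = ⊤ := by
    rw [eq_top_iff]
    intro y _
    have hy : y ∈ Algebra.adjoin A (Set.range ![x0, x1]) := by rw [hadj]; trivial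
    induction hy using Algebra.adjoin_induction with
    | mem x hx => exact Algebra.subset_adjoin hx
    | algebraMap r => exact Subalgebra.algebraMap_mem _ (a0 r)
    | add x y _ _ h1 h2 => exact add_mem (h1 trivial) (h2 trivial)
    | mul x y _ _ h1 h2 => exact mul_mem (h1 trivial) (h2 trivial)
  haveI : Algebra.FiniteType (𝒜 0) S := 
    ⟨⟨(Set.finite_range ![x0, x1]).toFinset, by simpa using hadj'⟩⟩
  haveI : IsClosedImmersion (Spec.map (CommRingCat.ofHom a0)) := IsClosedImmersion.spec_of_surjective _ ha0
  have hn0 : φ.toRingHom x0 ≠ 0 := by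
    change φ x0 ≠ 0
    rw [hφ0]; exact one_ne_zero
  have hn1 : φ.toRingHom x1 ≠ 0 := by
    change φ x1 ≠ 0
    rw [hφ1]; exact hz
  have hx01 : φ.toRingHom (x0 * x1) ≠ 0 := by rw [map_mul]; exact mul_ne_zero hn0 hn1
  let i : Spec (.of κ) ⟶ Proj 𝒜 := Spec.map (CommRingCat.ofHom (psi 𝒜 φ.toRingHom (x0 * x1) hx01)) ≫
    Proj.awayι 𝒜 (x0 * x1) (SetLike.mul_mem_graded hd0 hd1) (by norm_num)
  have e0 : Spec.map (CommRingCat.ofHom (psi 𝒜 φ.toRingHom x0 hn0)) ≫ Proj.awayι 𝒜 x0 hd0 one_pos = i := by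
    rw [← psi_awayMap 𝒜 φ.toRingHom x0 x1 (x0 * x1) rfl hn0 hx01 hd1, CommRingCat.ofHom_comp, Spec.map_comp,
      Category.assoc, Proj.SpecMap_awayMap_awayι]
  have e1 : Spec.map (CommRingCat.ofHom (psi 𝒜 φ.toRingHom x1 hn1)) ≫ Proj.awayι 𝒜 x1 hd1 one_pos = i := by
    rw [← psi_awayMap 𝒜 φ.toRingHom x1 x0 (x0 * x1) (mul_comm _ _) hn1 hx01 hd0, CommRingCat.ofHom_comp, Spec.map_comp,
      Category.assoc, Proj.SpecMap_awayMap_awayι]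
  refine ⟨Proj 𝒜, Proj.toSpecZero 𝒜 ≫ Spec.map (CommRingCat.ofHom a0), inferInstance, i, ?_, ?_⟩
  · rw [← e0, Category.assoc, Proj.awayι_toSpecZero_assoc, ← Spec.map_comp, ← Spec.map_comp]
    congr 1
    ext a
    refine (psi_fromZero 𝒜 φ.toRingHom x0 hn0 (a0 a)).trans ?_
    exact φ.commutes a
  · intro x
    have hd : ∀ j, ![x0, x1] j ∈ 𝒜 1 := by
      intro j; fin_cases j
      · exact hd0
      · exact hd1
    have hcov := Proj.iSup_basicOpen_eq_top' 𝒜 ![x0, x1] (fun j => ⟨1, hd j⟩) hadj'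
    have hx : x ∈ (⨆ j, Proj.basicOpen 𝒜 (![x0, x1] j)) := by
      rw [hcov]; trivial
    obtain ⟨j, hj⟩ := TopologicalSpace.Opens.mem_iSup.mp hx
    rw [← Proj.opensRange_awayι 𝒜 _ (hd j) one_pos] at hj
    fin_cases j
    · refine ⟨_, Proj.awayι 𝒜 x0 hd0 one_pos, inferInstance, _, hj, e0, ?_⟩
      rintro _ rfl
      left
      refine SecAt.spec _ (Away.mk 𝒜 hd0 1 x1 (by simpa using hd1)) _ ?_
      rw [psi_mk]
      change φ x1 / φ x0 ^ 1 = _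
      rw [hφ0, hφ1]; simp
    · refine ⟨_, Proj.awayι 𝒜 x1 hd1 one_pos, inferInstance, _, hj, e1, ?_⟩
      rintro _ rfl
      right
      refine SecAt.spec _ (Away.mk 𝒜 hd1 1 x0 (by simpa using hd0)) _ ?_
      rw [psi_mk]
      change φ x0 / φ x1 ^ 1 = _
      rw [hφ0, hφ1]; simp

open MvPolynomial in
lemma s5p1 (A κ : Type u) [CommRing A] [Field κ] [Algebra A κ] (z : κ) (hz : z ≠ 0) :
    ∃ (P : Scheme.{u}) (p : P ⟶ Spec (.of A)) (_ : IsProper p) (i : Spec (.of κ) ⟶ P),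
      IsGoodP p i {z} := by
  letI : GradedAlgebra (homogeneousSubmodule (Fin 2) A) := MvPolynomial.gradedAlgebra
  refine s5p0 A κ (MvPolynomial (Fin 2) A) (homogeneousSubmodule (Fin 2) A) z hz (aeval ![1, z]) (X 0) (X 1)
    (isHomogeneous_X A _) (isHomogeneous_X A _) (by simp) (by simp) ?_ ?_
  · intro x hx
    rw [homogeneousSubmodule_zero, Submodule.mem_one] at hx
    exact hx
  · have h1 := MvPolynomial.adjoin_range_X (R := A) (σ := Fin 2)
    have h2 : (![X 0, X 1] : Fin 2 → MvPolynomial (Fin 2) A) = X := by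
      funext j
      fin_cases j <;> rfl
    rw [h2]
    exact h1

lemma s5prod {A κ : Type u} [CommRing A] [Field κ] [Algebra A κ] {P P' : Scheme.{u}} (p : P ⟶ Spec (.of A))
    (p' : P' ⟶ Spec (.of A)) [IsProper p] [IsProper p']
    (i : Spec (.of κ) ⟶ P) (i' : Spec (.of κ) ⟶ P') (E E' : Set κ) (h : IsGoodP p i E) (h' : IsGoodP p' i' E') :
    ∃ (P : Scheme.{u}) (p : P ⟶ Spec (.of A)) (_ : IsProper p) (i : Spec (.of κ) ⟶ P),
      IsGoodP p i (E ∪ E') := by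
  refine ⟨pullback p p', pullback.fst p p' ≫ p, inferInstance, pullback.lift i i' (h.1.trans h'.1.symm), ?_, ?_⟩
  · rw [pullback.lift_fst_assoc]; exact h.1
  · intro x
    obtain ⟨U, u, hu, j, hx, hj, hz⟩ := h.2 (pullback.fst p p' x)
    obtain ⟨U', u', hu', j', hx', hj', hz'⟩ := h'.2 (pullback.snd p p' x)
    let W : (pullback p p').Opens := (pullback.fst p p' ⁻¹ᵁ u.opensRange) ⊓ (pullback.snd p p' ⁻¹ᵁ u'.opensRange)
    have hi : Set.range (pullback.lift i i' (h.1.trans h'.1.symm)) ⊆ Set.range W.ι := by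
      rw [Scheme.Opens.range_ι]
      rintro _ ⟨s, rfl⟩
      refine ⟨?_, ?_⟩
      · change pullback.fst p p' (pullback.lift i i' (h.1.trans h'.1.symm) s) ∈ Set.range u
        rw [← Scheme.Hom.comp_apply, pullback.lift_fst, ← hj]
        exact ⟨j s, (Scheme.Hom.comp_apply _ _ _).symm⟩
      · change pullback.snd p p' (pullback.lift i i' (h.1.trans h'.1.symm) s) ∈ Set.range u'
        rw [← Scheme.Hom.comp_apply, pullback.lift_snd, ← hj']
        exact ⟨j' s, (Scheme.Hom.comp_apply _ _ _).symm⟩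
    have hW : Set.range (W.ι ≫ pullback.fst p p') ⊆ Set.range u := by
      rintro _ ⟨s, rfl⟩
      rw [Scheme.Hom.comp_apply]
      exact s.2.1
    have hW' : Set.range (W.ι ≫ pullback.snd p p') ⊆ Set.range u' := by
      rintro _ ⟨s, rfl⟩
      rw [Scheme.Hom.comp_apply]
      exact s.2.2
    have e1 : IsOpenImmersion.lift W.ι _ hi ≫ IsOpenImmersion.lift u _ hW = j := by
      rw [← cancel_mono u, Category.assoc, IsOpenImmersion.lift_fac, IsOpenImmersion.lift_fac_assoc,
        pullback.lift_fst, hj]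
    have e2 : IsOpenImmersion.lift W.ι _ hi ≫ IsOpenImmersion.lift u' _ hW' = j' := by
      rw [← cancel_mono u', Category.assoc, IsOpenImmersion.lift_fac, IsOpenImmersion.lift_fac_assoc,
        pullback.lift_snd, hj']
    refine ⟨W, W.ι, inferInstance, IsOpenImmersion.lift W.ι _ hi, ?_, IsOpenImmersion.lift_fac _ _ _, ?_⟩
    · rw [Scheme.Opens.range_ι]
      exact ⟨hx, hx'⟩
    · rintro z (hzE | hzE)
      · rcases hz z hzE with H | H
        · exact Or.inl (SecAt.comp _ _ _ (e1 ▸ H))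
        · exact Or.inr (SecAt.comp _ _ _ (e1 ▸ H))
      · rcases hz' z hzE with H | H
        · exact Or.inl (SecAt.comp _ _ _ (e2 ▸ H))
        · exact Or.inr (SecAt.comp _ _ _ (e2 ▸ H))

lemma s5 (A κ : Type u) [CommRing A] [Field κ] [Algebra A κ] (E : Finset κ) :
    ∃ (P : Scheme.{u}) (p : P ⟶ Spec (.of A)) (_ : IsProper p) (i : Spec (.of κ) ⟶ P),
      IsGoodP p i E := by
  classical
  induction E using Finset.induction_on with
  | empty =>
    refine ⟨_, 𝟙 _, inferInstance, Spec.map (CommRingCat.ofHom (algebraMap A κ)), Category.comp_id _, ?_⟩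
    intro x
    exact ⟨_, 𝟙 _, inferInstance, _, ⟨x, rfl⟩, Category.comp_id _, by simp⟩
  | insert z E _ ih =>
    obtain ⟨P, p, hp, i, h⟩ := ih
    by_cases hz : z = 0
    · refine ⟨P, p, hp, i, h.1, fun x => ?_⟩
      obtain ⟨U, u, hu, j, hx, hj, hE⟩ := h.2 x
      refine ⟨U, u, hu, j, hx, hj, ?_⟩
      intro w hw
      rcases Finset.mem_insert.mp (Finset.mem_coe.mp hw) with rfl | hw
      · left
        exact ⟨0, by rw [map_zero, map_zero, hz]⟩
      · exact hE w hw
    · obtain ⟨P', p', hp', i', h'⟩ := s5p1 A κ z hz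
      obtain ⟨Q, q, hq, k, hk⟩ := s5prod p' p i' i _ _ h' h
      refine ⟨Q, q, hq, k, ?_⟩
      rwa [Finset.coe_insert, Set.insert_eq]

lemma std_toImage {X Y : Scheme.{u}} (f : X ⟶ Y) [QuasiCompact f] : IsSchemeTheoreticallyDominant f.toImage := by
  rw [isSchemeTheoreticallyDominant_iff]
  refine Scheme.IdealSheafData.ext_of_iSup_eq_top
    (fun U : Y.affineOpens => ⟨f.imageι ⁻¹ᵁ U.1, U.2.preimage f.imageι⟩) ?_ fun U => ?_
  · have h := iSup_affineOpens_eq_top Y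
    have h2 := congr(f.imageι ⁻¹ᵁ $h)
    rw [Scheme.Hom.preimage_iSup] at h2
    exact h2
  · rw [Scheme.Hom.ker_apply]
    refine ((RingHom.injective_iff_ker_eq_bot _).mp (f.toImage_app_injective U)).trans ?_
    simp

lemma lfp_of_noeth {A : Type u} [CommRing A] [IsNoetherianRing A] {X : Scheme.{u}} (f : X ⟶ Spec (.of A))
    [LocallyOfFiniteType f] : LocallyOfFinitePresentation f := by
  exact LocallyOfFinitePresentation.iff_locallyOfFiniteType.mpr inferInstance

lemma s6im (A κ : Type u) [CommRing A] [Field κ] [Algebra A κ] (E : Finset κ) :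
    ∃ (P : Scheme.{u}) (p : P ⟶ Spec (.of A)) (_ : IsProper p) (i : Spec (.of κ) ⟶ P)
      (_ : IsSchemeTheoreticallyDominant i), IsGoodP p i E := by
  obtain ⟨P, p, hp, i, h1, h2⟩ := s5 A κ E
  haveI : IsSeparated (i ≫ p) := by rw [h1]; infer_instance
  haveI : QuasiCompact i := by
    haveI : QuasiCompact (i ≫ p) := by rw [h1]; infer_instance
    exact QuasiCompact.of_comp i p
  refine ⟨i.image, i.imageι ≫ p, inferInstance, i.toImage, std_toImage i, ?_, ?_⟩
  · rw [Scheme.Hom.toImage_imageι_assoc, h1]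
  · intro x
    obtain ⟨U, u, hu, j, ⟨y, hy⟩, hj, hE⟩ := h2 (i.imageι x)
    refine ⟨pullback i.imageι u, pullback.fst _ _, inferInstance, pullback.lift i.toImage j
      ((Scheme.Hom.toImage_imageι _).trans hj.symm), ?_, pullback.lift_fst _ _ _, ?_⟩
    · obtain ⟨z, hz, _⟩ := Scheme.Pullback.exists_preimage_pullback x y hy.symm
      exact ⟨z, hz⟩
    · intro z hz
      have e := pullback.lift_snd (f := i.imageι) (g := u) i.toImage j
        ((Scheme.Hom.toImage_imageι _).trans hj.symm)
      rcases hE z hz with H | H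
      · exact Or.inl (SecAt.comp _ _ _ (e ▸ H))
      · exact Or.inr (SecAt.comp _ _ _ (e ▸ H))

open TensorProduct in
lemma s6alg {A B κ R : Type u} [CommRing A] [CommRing B] [Algebra A B] [Module.Flat A B] [Field κ] [Algebra A κ]
    [CommRing R] [Algebra A R] (ρ : R →ₐ[A] κ) (hρ : Function.Injective ρ)
    {Y : Scheme.{u}} (g : Y ⟶ Spec (.of B)) (t : Spec (.of (B ⊗[A] κ)) ⟶ Y) (E : Finset κ)
    (hQ : ∀ ε, Qext g t (Reps B ε E)) (hE : ∀ z ∈ E, (∃ r, ρ r = z) ∨ (∃ r, ρ r = z⁻¹)) :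
    ∃ β : Spec (.of (B ⊗[A] R)) ⟶ Y, β ≫ g = Spec.map (CommRingCat.ofHom (algebraMap B (B ⊗[A] R))) ∧
      Spec.map (CommRingCat.ofHom (Algebra.TensorProduct.map (AlgHom.id B B) ρ).toRingHom) ≫ β = t := by
  classical
  let θ : B ⊗[A] R →ₐ[B] B ⊗[A] κ := Algebra.TensorProduct.map (AlgHom.id B B) ρ
  have hθ : Function.Injective θ :=
    Module.Flat.lTensor_preserves_injective_linearMap (M := B) ρ.toLinearMap hρ
  let ε : κ → Bool := fun z => decide (∃ r, ρ r = z)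
  have hle : Reps B ε E ≤ θ.range := by
    refine Algebra.adjoin_le ?_
    rintro _ ⟨z, hz, rfl⟩
    have : ∃ r, ρ r = el ε z := by
      by_cases h : ∃ r, ρ r = z
      · simp [el, ε, h]
      · have := (hE z hz).resolve_left h
        simpa [el, ε, h] using this
    obtain ⟨r, hr⟩ := this
    exact ⟨1 ⊗ₜ r, by simp [θ, hr]⟩
  obtain ⟨b, h1, h2⟩ := Qext_mono g t _ _ hle (hQ ε)
  let e : θ.range ≃ₐ[B] B ⊗[A] R := (AlgEquiv.ofInjective θ hθ).symm
  refine ⟨Spec.map (CommRingCat.ofHom e.toAlgHom.toRingHom) ≫ b, ?_, ?_⟩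
  · rw [Category.assoc, h1, ← Spec.map_comp]
    congr 1
    ext x
    exact e.toAlgHom.commutes x
  · rw [← h2, ← Spec.map_comp_assoc]
    congr 2
    ext x
    exact congrArg Subtype.val ((AlgEquiv.ofInjective θ hθ).apply_symm_apply x)

open TensorProduct in
lemma s6loc {A B κ R : Type u} [CommRing A] [CommRing B] [Algebra A B] [Module.Flat A B] [Field κ] [Algebra A κ]
    [CommRing R] [Algebra A R] (ρ : R →ₐ[A] κ) (hρ : Function.Injective ρ)
    {Y : Scheme.{u}} (g : Y ⟶ Spec (.of B)) (t : Spec (.of (B ⊗[A] κ)) ⟶ Y) (E : Finset κ)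
    (hQ : ∀ ε, Qext g t (Reps B ε E)) (hE : ∀ z ∈ E, (∃ r, ρ r = z) ∨ (∃ r, ρ r = z⁻¹))
    {W : Scheme.{u}} (w1 : W ⟶ Spec (.of B)) (w2 : W ⟶ Spec (.of R))
    (hw : w1 ≫ Spec.map (CommRingCat.ofHom (algebraMap A B)) = w2 ≫ Spec.map (CommRingCat.ofHom (algebraMap A R)))
    (j : Spec (.of (B ⊗[A] κ)) ⟶ W) (hj1 : j ≫ w1 = Spec.map (CommRingCat.ofHom (algebraMap B (B ⊗[A] κ))))
    (hj2 : j ≫ w2 = Spec.map (CommRingCat.ofHom ((Algebra.TensorProduct.includeRight : κ →ₐ[A] B ⊗[A] κ).comp ρ).toRingHom)) :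
    ∃ φ : W ⟶ Y, φ ≫ g = w1 ∧ j ≫ φ = t := by
  obtain ⟨β, h1, h2⟩ := s6alg ρ hρ g t E hQ hE
  have hp := isPullback_SpecMap_of_isPushout _ _ _ _ (CommRingCat.isPushout_tensorProduct A B R)
  refine ⟨hp.lift w1 w2 hw ≫ β, ?_, ?_⟩
  · rw [Category.assoc, h1]
    exact hp.lift_fst w1 w2 hw
  · rw [← h2, ← Category.assoc]
    congr 1
    apply hp.hom_ext
    · rw [Category.assoc, hp.lift_fst, hj1]
      refine Eq.trans ?_ (Spec.map_comp _ _)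
      congr 1
      ext x
      exact ((Algebra.TensorProduct.map (AlgHom.id B B) ρ).commutes x).symm
    · rw [Category.assoc, hp.lift_snd, hj2]
      refine Eq.trans ?_ (Spec.map_comp _ _)
      congr 1

lemma s6uni {A κ : Type u} [CommRing A] [Field κ] [Algebra A κ] {U : Scheme.{u}} (c : U ⟶ Spec (.of A))
    (i : Spec (.of κ) ⟶ U) [IsSchemeTheoreticallyDominant i] [QuasiCompact i]
    (hc : i ≫ c = Spec.map (CommRingCat.ofHom (algebraMap A κ))) :
    ∃ (R : Type u) (_ : CommRing R) (_ : Algebra A R) (ρ : R →ₐ[A] κ) (r : U ⟶ Spec (.of R)),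
      Function.Injective ρ ∧ r ≫ Spec.map (CommRingCat.ofHom (algebraMap A R)) = c ∧
      i ≫ r = Spec.map (CommRingCat.ofHom ρ.toRingHom) ∧ ∀ z, SecAt i z → ∃ r, ρ r = z := by
  let a : CommRingCat.of A ⟶ Γ(U, ⊤) := (Scheme.ΓSpecIso (.of A)).inv ≫ c.appTop
  let ρ : Γ(U, ⊤) ⟶ CommRingCat.of κ := i.appTop ≫ (Scheme.ΓSpecIso (.of κ)).hom
  have h1 : U.toSpecΓ ≫ Spec.map a = c := by
    simp only [a]
    rw [Spec.map_comp, ← Scheme.toSpecΓ_naturality_assoc, toSpecΓ_SpecMap_ΓSpecIso_inv, Category.comp_id]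
  have h2 : i ≫ U.toSpecΓ = Spec.map ρ := by
    simp only [ρ]
    rw [Spec.map_comp, Scheme.toSpecΓ_naturality, SpecMap_ΓSpecIso_hom]
  have h3 : a ≫ ρ = CommRingCat.ofHom (algebraMap A κ) := by
    apply Spec.map_injective
    rw [Spec.map_comp, ← h2, Category.assoc, h1, hc]
  letI : Algebra A Γ(U, ⊤) := a.hom.toAlgebra
  refine ⟨Γ(U, ⊤), inferInstance, inferInstance, { ρ.hom with commutes' := fun x => congr($h3 x) }, U.toSpecΓ,
    ?_, h1, h2, ?_⟩
  · have := i.app_injective ⊤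
    exact (Scheme.ΓSpecIso (.of κ)).commRingCatIsoToRingEquiv.injective.comp this
  · rintro z ⟨s, hs⟩
    exact ⟨s, hs⟩

lemma std_factor {T X U : Scheme.{u}} (i : T ⟶ X) (u : U ⟶ X) [IsOpenImmersion u] (j : T ⟶ U) (h : j ≫ u = i)
    [IsSchemeTheoreticallyDominant i] [QuasiCompact i] : IsSchemeTheoreticallyDominant j ∧ QuasiCompact j := by
  have hm : Mono (pullback.fst i u) := inferInstance
  have e : pullback.lift (𝟙 T) j (by rw [h, Category.id_comp]) ≫ pullback.fst i u = 𝟙 T := pullback.lift_fst _ _ _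
  haveI : IsSplitEpi (pullback.fst i u) := IsSplitEpi.mk' ⟨_, e⟩
  haveI : IsIso (pullback.fst i u) := isIso_of_mono_of_isSplitEpi _
  haveI : IsIso (pullback.lift (𝟙 T) j (by rw [h, Category.id_comp]) : T ⟶ pullback i u) := by
    have := (IsIso.eq_comp_inv _).mpr e
    rw [this]; infer_instance
  have e2 : pullback.lift (𝟙 T) j (by rw [h, Category.id_comp]) ≫ pullback.snd i u = j := pullback.lift_snd _ _ _
  rw [← e2]
  exact ⟨inferInstance, inferInstance⟩

open TensorProduct in
lemma s6j {A B κ : Type u} [CommRing A] [CommRing B] [Algebra A B] [Module.Flat A B] [Field κ] [Algebra A κ]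
    {X : Scheme.{u}} (f : X ⟶ Spec (.of A)) (i : Spec (.of κ) ⟶ X) [QuasiCompact i] [IsSchemeTheoreticallyDominant i]
    (hi : i ≫ f = Spec.map (CommRingCat.ofHom (algebraMap A κ))) :
    ∃ (j : Spec (.of (B ⊗[A] κ)) ⟶ pullback f (Spec.map (CommRingCat.ofHom (algebraMap A B)))),
      IsSchemeTheoreticallyDominant j ∧ QuasiCompact j ∧
      j ≫ pullback.fst f (Spec.map (CommRingCat.ofHom (algebraMap A B))) =
        Spec.map (CommRingCat.ofHom (Algebra.TensorProduct.includeRight : κ →ₐ[A] B ⊗[A] κ).toRingHom) ≫ i ∧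
      j ≫ pullback.snd f (Spec.map (CommRingCat.ofHom (algebraMap A B))) =
        Spec.map (CommRingCat.ofHom (algebraMap B (B ⊗[A] κ))) := by
  have hp := isPullback_SpecMap_of_isPushout _ _ _ _ (CommRingCat.isPushout_tensorProduct A B κ)
  haveI : Flat (Spec.map (CommRingCat.ofHom (algebraMap A B))) := by
    rw [Flat.SpecMap_iff]
    exact RingHom.flat_algebraMap_iff.mpr inferInstance
  have hw : (Spec.map (CommRingCat.ofHom (Algebra.TensorProduct.includeRight : κ →ₐ[A] B ⊗[A] κ).toRingHom) ≫ i) ≫ f =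
      Spec.map (CommRingCat.ofHom (algebraMap B (B ⊗[A] κ))) ≫ Spec.map (CommRingCat.ofHom (algebraMap A B)) := by
    rw [Category.assoc, hi]
    exact hp.w.symm
  let j := pullback.lift _ _ hw
  have hj1 : j ≫ pullback.fst f (Spec.map (CommRingCat.ofHom (algebraMap A B))) = _ := pullback.lift_fst _ _ hw
  have hj2 : j ≫ pullback.snd f (Spec.map (CommRingCat.ofHom (algebraMap A B))) = _ := pullback.lift_snd _ _ hw
  have hpb : IsPullback (Spec.map (CommRingCat.ofHom (Algebra.TensorProduct.includeRight : κ →ₐ[A] B ⊗[A] κ).toRingHom))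
      j i (pullback.fst f (Spec.map (CommRingCat.ofHom (algebraMap A B)))) := by
    refine IsPullback.flip (IsPullback.of_right (h₁₂ := pullback.snd f (Spec.map (CommRingCat.ofHom (algebraMap A B))))
      (v₁₃ := Spec.map (CommRingCat.ofHom (algebraMap A B))) (h₂₂ := f) ?_ hj1 (IsPullback.of_hasPullback f _).flip)
    rw [hj2, hi]
    exact hp
  refine ⟨j, IsSchemeTheoreticallyDominant.of_isPullback hpb, ?_, hj1, hj2⟩
  exact MorphismProperty.of_isPullback (P := @QuasiCompact) hpb inferInstance

open TensorProduct in
lemma s6 {A B κ : Type u} [CommRing A] [CommRing B] [Algebra A B] [Algebra.Etale A B] [Field κ] [Algebra A κ]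
    {Y : Scheme.{u}} (g : Y ⟶ Spec (.of B)) [IsProper g] (t : Spec (.of (B ⊗[A] κ)) ⟶ Y) (E : Finset κ)
    (hQ : ∀ ε, Qext g t (Reps B ε E))
    {X : Scheme.{u}} (f : X ⟶ Spec (.of A)) (i : Spec (.of κ) ⟶ X) [QuasiCompact i] [IsSchemeTheoreticallyDominant i]
    (hX : IsGoodP f i E) :
    ∃ φ : pullback f (Spec.map (CommRingCat.ofHom (algebraMap A B))) ⟶ Y, φ ≫ g = pullback.snd _ _ := by
  obtain ⟨j, hj, hj', hj1, hj2⟩ := s6j (B := B) f i hX.1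
  haveI : _root_.IsReduced (B ⊗[A] κ) := (etale_facts A B κ).1
  haveI : IsReduced (Spec (.of (B ⊗[A] κ))) := (affine_isReduced_iff _).mpr inferInstance
  haveI := IsSchemeTheoreticallyDominant.isReduced j
  have key := lemG j (pullback.snd f (Spec.map (CommRingCat.ofHom (algebraMap A B)))) g t ?_
  · obtain ⟨φ, h, _⟩ := key
    exact ⟨φ, h⟩
  intro x
  obtain ⟨U, u, hu, i', ⟨y, hy⟩, hi', hE⟩ := hX.2 (pullback.fst f (Spec.map (CommRingCat.ofHom (algebraMap A B))) x)
  obtain ⟨hS, hqc⟩ := std_factor i u i' hi'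
  obtain ⟨R, _, _, ρ, r, hρ, hr, hir, hsec⟩ := s6uni (u ≫ f) i' (by rw [← Category.assoc, hi', hX.1])
  have hw : j ≫ pullback.fst f (Spec.map (CommRingCat.ofHom (algebraMap A B))) =
      (Spec.map (CommRingCat.ofHom (Algebra.TensorProduct.includeRight : κ →ₐ[A] B ⊗[A] κ).toRingHom) ≫ i') ≫ u := by
    rw [hj1, Category.assoc, hi']
  obtain ⟨φ, h1, h2⟩ := s6loc ρ hρ g t E hQ (fun z hz => (hE z hz).imp (hsec z) (hsec _))
    (W := pullback (pullback.fst f (Spec.map (CommRingCat.ofHom (algebraMap A B)))) u)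
    (pullback.fst _ _ ≫ pullback.snd f (Spec.map (CommRingCat.ofHom (algebraMap A B))))
    (pullback.snd _ _ ≫ r)
    (by rw [Category.assoc, Category.assoc, hr, ← pullback.condition, pullback.condition_assoc])
    (pullback.lift j _ hw)
    (by rw [pullback.lift_fst_assoc, hj2])
    (by
      rw [pullback.lift_snd_assoc, Category.assoc, hir]
      exact (Spec.map_comp _ _).symm)
  refine ⟨_, pullback.fst _ _, inferInstance, φ, pullback.lift j _ hw, ?_, h1, pullback.lift_fst _ _ _, h2⟩
  obtain ⟨z, hz, _⟩ := Scheme.Pullback.exists_preimage_pullback x y hy.symm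
  exact ⟨z, hz⟩

lemma std_factor2 {T X U : Scheme.{u}} (i : T ⟶ X) (u : U ⟶ X) [Mono u] [Flat u] (j : T ⟶ U) (h : j ≫ u = i)
    [IsSchemeTheoreticallyDominant i] [QuasiCompact i] : IsSchemeTheoreticallyDominant j ∧ QuasiCompact j := by
  have hm : Mono (pullback.fst i u) := inferInstance
  have e : pullback.lift (𝟙 T) j (by rw [h, Category.id_comp]) ≫ pullback.fst i u = 𝟙 T := pullback.lift_fst _ _ _
  haveI : IsSplitEpi (pullback.fst i u) := IsSplitEpi.mk' ⟨_, e⟩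
  haveI : IsIso (pullback.fst i u) := isIso_of_mono_of_isSplitEpi _
  haveI : IsIso (pullback.lift (𝟙 T) j (by rw [h, Category.id_comp]) : T ⟶ pullback i u) := by
    have := (IsIso.eq_comp_inv _).mpr e
    rw [this]; infer_instance
  have e2 : pullback.lift (𝟙 T) j (by rw [h, Category.id_comp]) ≫ pullback.snd i u = j := pullback.lift_snd _ _ _
  rw [← e2]
  exact ⟨inferInstance, inferInstance⟩

lemma iso_of_ci_std {X Y : Scheme.{u}} (s : X ⟶ Y) [IsClosedImmersion s] [IsSchemeTheoreticallyDominant s] : IsIso s := by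
  haveI : IsIso s.imageι := by
    apply (Scheme.isIso_subschemeι_iff_eq_bot s.ker).mpr
    exact s.ker_eq_bot
  rw [← s.toImage_imageι]
  infer_instance

lemma s7 {X S Z T : Scheme.{u}} (f : X ⟶ S) [IsSeparated f] (b : Z ⟶ S) [Mono b] [Flat b] (c : T ⟶ Z) [IsClosedImmersion c]
    (i : T ⟶ X) [IsSchemeTheoreticallyDominant i] [QuasiCompact i] (h : i ≫ f = c ≫ b) :
    IsIso (pullback.lift i c h) := by
  obtain ⟨h1, h2⟩ := std_factor2 i (pullback.fst f b) (pullback.lift i c h) (pullback.lift_fst _ _ _)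
  haveI : IsClosedImmersion (pullback.lift i c h ≫ pullback.snd f b) := by
    rw [pullback.lift_snd]; infer_instance
  haveI : IsClosedImmersion (pullback.lift i c h) := IsClosedImmersion.of_comp _ (pullback.snd f b)
  exact iso_of_ci_std _

lemma pbSigma {ι : Type u} [Finite ι] {S Z : Scheme.{u}} (X : ι → Scheme.{u}) (f : ∀ i, X i ⟶ S) (b : Z ⟶ S) :
    Nonempty (IsColimit (Cofan.mk (f := fun i => pullback (f i) b) (pullback (Sigma.desc f) b) (fun i =>
      pullback.map (f i) b (Sigma.desc f) b (Sigma.ι X i) (𝟙 Z) (𝟙 S) (by simp) (by simp)))) := by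
  refine FinitaryPreExtensive.isUniversal_finiteCoproducts (coproductIsCoproduct X) _
    (Discrete.natTrans fun i => pullback.fst (f i.as) b) (pullback.fst _ _) ?_ (NatTrans.Equifibered.of_discrete _) ?_
  · ext ⟨i⟩
    exact (pullback.lift_fst _ _ _).symm
  · rintro ⟨i⟩
    change IsPullback (pullback.map (f i) b (Sigma.desc f) b (Sigma.ι X i) (𝟙 Z) (𝟙 S) (by simp) (by simp)) (pullback.fst (f i) b)
      (pullback.fst (Sigma.desc f) b) (Sigma.ι X i)
    refine IsPullback.of_right (h₁₂ := pullback.snd (Sigma.desc f) b) (h₂₂ := Sigma.desc f) (v₁₃ := b) ?_ ?_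
      (IsPullback.of_hasPullback _ _).flip
    · have e1 : pullback.map (f i) b (Sigma.desc f) b (Sigma.ι X i) (𝟙 Z) (𝟙 S) (by simp) (by simp) ≫
          pullback.snd (Sigma.desc f) b = pullback.snd (f i) b := by
        rw [pullback.lift_snd, Category.comp_id]
      have e2 : Sigma.ι X i ≫ Sigma.desc f = f i := Sigma.ι_desc _ _
      rw [e1]
      have e3 : ∀ w, w = f i → IsPullback (pullback.snd (f i) b) (pullback.fst (f i) b) b w := by
        rintro _ rfl
        exact (IsPullback.of_hasPullback _ _).flip
      exact e3 _ e2
    · exact pullback.lift_fst _ _ _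

lemma properSigma {ι : Type u} [Finite ι] {A : Type u} [CommRing A] (X : ι → Scheme.{u}) (f : ∀ i, X i ⟶ Spec (.of A))
    (hf : ∀ i, IsProper (f i)) : IsProper (Sigma.desc f) := by
  have e : Sigma.desc f = Limits.Sigma.map f ≫ Sigma.desc (fun _ => 𝟙 (Spec (.of A))) := by
    ext i : 1
    simp
  haveI h1 : IsProper (Limits.Sigma.map f) := by
    refine (IsZariskiLocalAtTarget.iff_of_openCover (P := @IsProper) (sigmaOpenCover (fun _ : ι => Spec (.of A)))).mpr ?_
    intro i
    have hv : IsPullback (Sigma.ι X i) (f i) (Limits.Sigma.map f) (Sigma.ι (fun _ : ι => Spec (.of A)) i) := by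
      have hvk := FinitaryExtensive.isVanKampen_finiteCoproducts (coproductIsCoproduct (fun _ : ι => Spec (.of A)))
      exact (hvk (Cofan.mk _ (Sigma.ι X)) (Discrete.natTrans fun i => f i.as) (Limits.Sigma.map f) (by
        ext ⟨i⟩
        exact (Limits.Sigma.ι_map f i).symm) (NatTrans.Equifibered.of_discrete _)).mp ⟨coproductIsCoproduct X⟩ ⟨i⟩
    have e2 : pullback.snd _ _ = hv.isoPullback.inv ≫ f i := (hv.isoPullback_inv_snd).symm
    have h3 : IsProper (hv.isoPullback.inv ≫ f i) := by
      have := hf i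
      exact (MorphismProperty.cancel_left_of_respectsIso @IsProper hv.isoPullback.inv (f i)).mpr this
    rw [← e2] at h3
    exact h3
  haveI h2 : IsProper (Sigma.desc (fun _ : ι => 𝟙 (Spec (.of A)))) := by
    haveI := specProd (CommRingCat.of (ι → A)) (fun _ => .of A) (fun i => CommRingCat.ofHom (Pi.evalRingHom _ i))
      Function.bijective_id
    have e3 : Sigma.desc (fun _ : ι => 𝟙 (Spec (.of A))) =
      Sigma.desc (fun i : ι => Spec.map (CommRingCat.ofHom (Pi.evalRingHom (fun _ => A) i))) ≫
      Spec.map (CommRingCat.ofHom (algebraMap A (ι → A))) := by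
      ext i : 1
      rw [Sigma.ι_desc, Sigma.ι_desc_assoc, ← Spec.map_comp, ← Spec.map_id]
      rfl
    haveI : IsFinite (Spec.map (CommRingCat.ofHom (algebraMap A (ι → A)))) := by
      rw [IsFinite.SpecMap_iff]
      exact RingHom.finite_algebraMap.mpr inferInstance
    rw [e3]
    infer_instance
  rw [e]
  infer_instance

lemma unit_fr (R : Type u) [CommRing R] (x : FractionRing R) (hx : x ∈ nonZeroDivisors (FractionRing R)) : IsUnit x := by
  obtain ⟨r, s, rfl⟩ := IsLocalization.exists_mk'_eq (nonZeroDivisors R) x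
  have hs : IsUnit (algebraMap R (FractionRing R) s) := IsLocalization.map_units _ s
  have e : IsLocalization.mk' (FractionRing R) r s * algebraMap R (FractionRing R) s = algebraMap R _ r :=
    IsLocalization.mk'_spec _ _ _
  have h1 : algebraMap R (FractionRing R) r ∈ nonZeroDivisors (FractionRing R) := by
    rw [← e]
    exact mul_mem hx hs.mem_nonZeroDivisors
  have h2 : r ∈ nonZeroDivisors R :=
    mem_nonZeroDivisors_of_injective (f := algebraMap R (FractionRing R)) (IsFractionRing.injective R (FractionRing R)) h1
  have h3 : IsUnit (algebraMap R (FractionRing R) r) := IsLocalization.map_units _ (⟨r, h2⟩ : nonZeroDivisors R)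
  rw [← e] at h3
  exact isUnit_of_mul_isUnit_left h3

lemma artin_of_units (R : Type u) [CommRing R] [IsNoetherianRing R] [_root_.IsReduced R]
    (h : ∀ x ∈ nonZeroDivisors R, IsUnit x) : IsArtinianRing R := by
  have hmax : ∀ m : Ideal R, m.IsMaximal → m ∈ minimalPrimes R := by
    intro m hm
    have hsub : (m : Set R) ⊆ ⋃ q ∈ minimalPrimes R, (q : Set R) := by
      intro x hx
      have hnz : x ∉ nonZeroDivisors R := fun hx' => hm.ne_top (Ideal.eq_top_of_isUnit_mem _ hx (h x hx'))
      rw [mem_nonZeroDivisors_iff_right] at hnz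
      push Not at hnz
      obtain ⟨y, hy, hy0⟩ := hnz
      have : y ∉ nilradical R := by
        rw [nilradical_eq_zero]; exact hy0
      rw [nilradical, ← Ideal.sInf_minimalPrimes, Submodule.mem_sInf] at this
      push Not at this
      obtain ⟨q, hq, hyq⟩ := this
      have hqp : Ideal.IsPrime q := hq.1.1
      simp only [Set.mem_iUnion]
      refine ⟨q, hq, (hqp.mem_or_mem (x := y) (y := x) (by rw [hy]; exact q.zero_mem)).resolve_left hyq⟩
    obtain ⟨q, hq, hmq⟩ := (Ideal.subset_union_prime_finite (minimalPrimes.finite_of_isNoetherianRing R)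
      (f := id) ⊤ ⊤ (fun q hq _ _ => hq.1.1)).mp hsub
    have hqp : q.IsPrime := hq.1.1
    have : m = q := hm.eq_of_le hqp.ne_top hmq
    rw [this]; exact hq
  rw [isArtinianRing_iff_krullDimLE_zero, Ring.krullDimLE_zero_iff]
  intro p hp
  obtain ⟨m, hm, hpm⟩ := Ideal.exists_le_maximal p hp.ne_top
  have hmin := hmax m hm
  have : p = m := le_antisymm hpm (hmin.2 ⟨hp, bot_le⟩ hpm)
  rw [this]; exact hm

lemma flat_quot (K : Type u) [CommRing K] [IsArtinianRing K] [_root_.IsReduced K] (m : MaximalSpectrum K) :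
    Module.Flat K (K ⧸ m.asIdeal) := by
  classical
  let e : K →ₗ[K] (∀ m : MaximalSpectrum K, K ⧸ m.asIdeal) := LinearMap.pi (fun m => Submodule.mkQ m.asIdeal)
  have he : Function.Bijective e := artin_crt K
  let e' := LinearEquiv.ofBijective e he
  refine Module.Flat.of_retract (e'.symm.toLinearMap ∘ₗ LinearMap.single K (fun m : MaximalSpectrum K => K ⧸ m.asIdeal) m)
    (LinearMap.proj m ∘ₗ e'.toLinearMap) ?_
  ext
  simp

open TensorProduct in
lemma red_B (A B K : Type u) [CommRing A] [CommRing B] [Algebra A B] [Algebra.Etale A B] [CommRing K] [Algebra A K]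
    [IsArtinianRing K] [_root_.IsReduced K] (hinj : Function.Injective (algebraMap A K)) : _root_.IsReduced B := by
  classical
  haveI : Fintype (MaximalSpectrum K) := Fintype.ofFinite _
  let e : A →ₗ[A] (∀ m : MaximalSpectrum K, K ⧸ m.asIdeal) := LinearMap.pi (fun m => Algebra.linearMap A (K ⧸ m.asIdeal))
  have he : Function.Injective e := (artin_crt K).1.comp hinj
  have h1 : Function.Injective (e.lTensor B) := Module.Flat.lTensor_preserves_injective_linearMap e he
  let F := (TensorProduct.piRight A A B (fun m : MaximalSpectrum K => K ⧸ m.asIdeal))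
  have h2 : Function.Injective (fun b : B => F (e.lTensor B (b ⊗ₜ 1))) :=
    F.injective.comp (h1.comp (TensorProduct.rid A B).symm.injective)
  refine ⟨fun b hb => h2 ?_⟩
  have h3 : ∀ c : B, F (e.lTensor B (c ⊗ₜ 1)) = fun m : MaximalSpectrum K => algebraMap B (B ⊗[A] (K ⧸ m.asIdeal)) c := by
    intro c
    ext m
    simp [F, e]
  simp only [h3]
  ext m
  letI : Field (K ⧸ m.asIdeal) := Ideal.Quotient.field _
  haveI := (etale_facts A B (K ⧸ m.asIdeal)).1
  rw [map_zero]
  exact (hb.map (algebraMap B (B ⊗[A] (K ⧸ m.asIdeal)))).eq_zero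

open TensorProduct in
lemma lift_fr (A B κ : Type u) [CommRing A] [CommRing B] [Algebra A B] [Algebra.Etale A B] [Field κ] [Algebra A κ]
    [Module.Flat A κ] [_root_.IsReduced B] : ∃ φ : FractionRing (B ⧸ nilradical B) →+* B ⊗[A] κ,
      φ.comp ((algebraMap (B ⧸ nilradical B) (FractionRing (B ⧸ nilradical B))).comp
    (Ideal.Quotient.mk (nilradical B))) = algebraMap B (B ⊗[A] κ) := by
  obtain ⟨hr, hfin⟩ := etale_facts A B κ
  haveI : IsArtinianRing (B ⊗[A] κ) := by
    letI := (Algebra.TensorProduct.includeRight : κ →ₐ[A] B ⊗[A] κ).toRingHom.toAlgebra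
    haveI : Module.Finite κ (B ⊗[A] κ) := hfin
    exact IsArtinianRing.of_finite κ _
  have hb : ∀ x ∈ nilradical B, algebraMap B (B ⊗[A] κ) x = 0 := by
    intro x hx
    rw [nilradical_eq_zero] at hx
    rw [show x = 0 from hx, map_zero]
  let ψ := Ideal.Quotient.lift (nilradical B) (algebraMap B (B ⊗[A] κ)) hb
  have hu : ∀ y : nonZeroDivisors (B ⧸ nilradical B), IsUnit (ψ y) := by
    rintro ⟨y, hy⟩
    obtain ⟨b, rfl⟩ := Ideal.Quotient.mk_surjective y
    have hb2 : b ∈ nonZeroDivisors B := by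
      refine mem_nonZeroDivisors_of_injective (f := Ideal.Quotient.mk (nilradical B)) ?_ hy
      rw [RingHom.injective_iff_ker_eq_bot, Ideal.mk_ker, nilradical_eq_zero]
      rfl
    apply IsArtinianRing.isUnit_of_mem_nonZeroDivisors
    have h3 : IsSMulRegular (B ⊗[A] κ) b := Module.Flat.isSMulRegular_of_nonZeroDivisors hb2
    rw [mem_nonZeroDivisors_iff_right]
    intro z hz
    apply h3
    change b • z = b • (0 : B ⊗[A] κ)
    rw [smul_zero, Algebra.smul_def, mul_comm]
    exact hz
  refine ⟨IsLocalization.lift hu, ?_⟩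
  ext b
  exact IsLocalization.lift_eq hu _

open TensorProduct in
lemma perm {A B κ : Type u} [CommRing A] [CommRing B] [Algebra A B] [Algebra.Etale A B] [Field κ] [Algebra A κ]
    {Y T : Scheme.{u}} (g : Y ⟶ Spec (.of B)) [IsProper g] [LocallyOfFinitePresentation g] (b : T ⟶ Spec (.of B))
    [IsIso (pullback.snd g b)] (r : Spec (.of (B ⊗[A] κ)) ⟶ T)
    (hr : r ≫ b = Spec.map (CommRingCat.ofHom (algebraMap B (B ⊗[A] κ)))) :
    ∃ (X : Scheme.{u}) (f : X ⟶ Spec (.of A)) (i : Spec (.of κ) ⟶ X),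
      IsProper f ∧ IsSchemeTheoreticallyDominant i ∧ QuasiCompact i ∧
      i ≫ f = Spec.map (CommRingCat.ofHom (algebraMap A κ)) ∧
      ∃ φ : pullback f (Spec.map (CommRingCat.ofHom (algebraMap A B))) ⟶ Y, φ ≫ g = pullback.snd _ _ := by
  obtain ⟨E, hE⟩ := s4 (A := A) (κ := κ) g (r ≫ inv (pullback.snd g b) ≫ pullback.fst g b) (by
    rw [Category.assoc, Category.assoc, pullback.condition, IsIso.inv_hom_id_assoc, hr])
  obtain ⟨P, p, hp, i, hi, hgood⟩ := s6im A κ E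
  haveI : QuasiCompact (i ≫ p) := by rw [hgood.1]; infer_instance
  haveI : QuasiCompact i := QuasiCompact.of_comp i p
  exact ⟨P, p, i, hp, hi, inferInstance, hgood.1, s6 g _ E hE p i hgood⟩

open TensorProduct in
lemma assemble {A B K : Type u} [CommRing A] [CommRing B] [Algebra A B] [CommRing K]
    [Algebra A K] [IsArtinianRing K] [_root_.IsReduced K] [Module.Flat A K]
    (hm : Mono (Spec.map (CommRingCat.ofHom (algebraMap A K)))) {Y : Scheme.{u}} (g : Y ⟶ Spec (.of B))
    (H : ∀ m : MaximalSpectrum K, ∃ (X : Scheme.{u}) (f : X ⟶ Spec (.of A)) (i : Spec (.of (K ⧸ m.asIdeal)) ⟶ X),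
      IsProper f ∧ IsSchemeTheoreticallyDominant i ∧ QuasiCompact i ∧
      i ≫ f = Spec.map (CommRingCat.ofHom (algebraMap A (K ⧸ m.asIdeal))) ∧
      ∃ φ : pullback f (Spec.map (CommRingCat.ofHom (algebraMap A B))) ⟶ Y, φ ≫ g = pullback.snd _ _) :
    ∃ (X : Scheme.{u}) (f : X ⟶ Spec (.of A)), IsProper f ∧
      IsIso (pullback.snd f (Spec.map (CommRingCat.ofHom (algebraMap A K)))) ∧
      ∃ φ : pullback f (Spec.map (CommRingCat.ofHom (algebraMap A B))) ⟶ Y, φ ≫ g = pullback.snd _ _ := by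
  choose X f i hf hi hq hif φ hφ using H
  refine ⟨∐ X, Sigma.desc f, properSigma X f hf, ?_, ?_⟩
  · haveI : Flat (Spec.map (CommRingCat.ofHom (algebraMap A K))) := by
      rw [Flat.SpecMap_iff]
      exact RingHom.flat_algebraMap_iff.mpr inferInstance
    have hc : ∀ m : MaximalSpectrum K, i m ≫ f m = Spec.map (CommRingCat.ofHom (Ideal.Quotient.mk m.asIdeal)) ≫
        Spec.map (CommRingCat.ofHom (algebraMap A K)) := by
      intro m
      have e : algebraMap A (K ⧸ m.asIdeal) = (Ideal.Quotient.mk m.asIdeal).comp (algebraMap A K) := rfl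
      rw [hif m, ← Spec.map_comp, ← CommRingCat.ofHom_comp, e]
    have hl : ∀ m, IsIso (pullback.lift (i m) _ (hc m)) := by
      intro m
      haveI : IsClosedImmersion (Spec.map (CommRingCat.ofHom (Ideal.Quotient.mk m.asIdeal))) :=
        IsClosedImmersion.spec_of_surjective _ Ideal.Quotient.mk_surjective
      have := hf m
      have := hi m
      have := hq m
      exact s7 (f m) _ _ (i m) (hc m)
    have hcol := pbSigma X f (Spec.map (CommRingCat.ofHom (algebraMap A K)))
    rw [Cofan.nonempty_isColimit_iff_isIso_sigmaDesc] at hcol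
    have hs := specProd (CommRingCat.of K) (fun m : MaximalSpectrum K => CommRingCat.of (K ⧸ m.asIdeal))
      (fun m => CommRingCat.ofHom (Ideal.Quotient.mk m.asIdeal)) (artin_crt K)
    refine @IsIso.of_isIso_comp_left _ _ _ _ _ _ _ hcol ?_
    refine @IsIso.of_isIso_comp_left _ _ _ _ _ (Limits.Sigma.map fun m => pullback.lift (i m) _ (hc m)) _ inferInstance ?_
    convert hs
    ext m : 1
    rw [Limits.Sigma.ι_map_assoc, Sigma.ι_desc_assoc, Sigma.ι_desc]
    change pullback.lift (i m) _ (hc m) ≫ pullback.lift _ _ _ ≫ _ = _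
    rw [pullback.lift_snd, Category.comp_id, pullback.lift_snd]
  · obtain ⟨hcol⟩ := pbSigma X f (Spec.map (CommRingCat.ofHom (algebraMap A B)))
    refine ⟨Cofan.IsColimit.desc hcol φ, Cofan.IsColimit.hom_ext hcol _ _ fun m => ?_⟩
    rw [Cofan.IsColimit.fac_assoc, hφ]
    exact ((pullback.lift_snd _ _ _).trans (Category.comp_id _)).symm

lemma frac_facts (A : Type u) [CommRing A] [IsNoetherianRing A] [_root_.IsReduced A] :
    IsArtinianRing (FractionRing (A ⧸ nilradical A)) ∧ _root_.IsReduced (FractionRing (A ⧸ nilradical A)) ∧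
    (totalFractionMap A).hom.Flat ∧ Function.Injective (totalFractionMap A).hom ∧ Mono (Spec.map (totalFractionMap A)) := by
  have hbij : Function.Bijective (Ideal.Quotient.mk (nilradical A)) := by
    refine ⟨?_, Ideal.Quotient.mk_surjective⟩
    rw [RingHom.injective_iff_ker_eq_bot, Ideal.mk_ker, nilradical_eq_zero]
    rfl
  haveI : _root_.IsReduced (A ⧸ nilradical A) := by
    rw [← Ideal.isRadical_iff_quotient_reduced]
    exact Ideal.radical_isRadical _
  haveI : IsNoetherianRing (FractionRing (A ⧸ nilradical A)) :=
    IsLocalization.isNoetherianRing (nonZeroDivisors (A ⧸ nilradical A)) _ inferInstance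
  have hred : _root_.IsReduced (FractionRing (A ⧸ nilradical A)) := inferInstanceAs (_root_.IsReduced (Localization _))
  refine ⟨artin_of_units _ (unit_fr _), hred, ?_, ?_, ?_⟩
  · refine RingHom.Flat.comp (RingHom.Flat.of_bijective hbij) ?_
    exact RingHom.flat_algebraMap_iff.mpr (IsLocalization.flat _ (nonZeroDivisors (A ⧸ nilradical A)))
  · exact (IsFractionRing.injective (A ⧸ nilradical A) _).comp hbij.1
  · have e : Spec.map (totalFractionMap A) =
      Spec.map (CommRingCat.ofHom (algebraMap (A ⧸ nilradical A) (FractionRing (A ⧸ nilradical A)))) ≫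
      Spec.map (CommRingCat.ofHom (Ideal.Quotient.mk (nilradical A))) := by
      rw [totalFractionMap, CommRingCat.ofHom_comp, Spec.map_comp]
    haveI : IsIso (CommRingCat.ofHom (Ideal.Quotient.mk (nilradical A))) :=
      (ConcreteCategory.isIso_iff_bijective _).mpr hbij
    haveI := IsPreimmersion.of_isLocalization (S := FractionRing (A ⧸ nilradical A)) (nonZeroDivisors (A ⧸ nilradical A))
    rw [e]
    infer_instance

lemma main_gen {A B K T : Type u} [CommRing A] [CommRing K] [CommRing T]
    [CommRing B] [Algebra A B] [Algebra.Etale A B] [IsArtinianRing K] [_root_.IsReduced K]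
    (j : CommRingCat.of A ⟶ CommRingCat.of K) (h3 : j.hom.Flat) (h4 : Function.Injective j.hom) (h5 : Mono (Spec.map j))
    (b : CommRingCat.of B ⟶ CommRingCat.of T)
    (hb : ∀ (κ : Type u) [Field κ] [Algebra A κ] [Module.Flat A κ] [_root_.IsReduced B],
      ∃ φ : T →+* TensorProduct A B κ, φ.comp b.hom = algebraMap B (TensorProduct A B κ))
    {Y : Scheme.{u}} (g : Y ⟶ Spec (CommRingCat.of B)) [IsProper g] [LocallyOfFinitePresentation g]
    [IsIso (pullback.snd g (Spec.map b))] :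
    ∃ (X : Scheme.{u}) (f : X ⟶ Spec (CommRingCat.of A)),
      IsProper f ∧ IsIso (pullback.snd f (Spec.map j)) ∧
      ∃ h : pullback f (Spec.map (CommRingCat.ofHom (algebraMap A B))) ⟶ Y,
        h ≫ g = pullback.snd f (Spec.map (CommRingCat.ofHom (algebraMap A B))) := by
  letI alg : Algebra A K := j.hom.toAlgebra
  haveI : Module.Flat A K := h3
  have hB := red_B A B K h4
  refine assemble (A := A) (B := B) (K := K) h5 g ?_
  intro m
  letI : Field (K ⧸ m.asIdeal) := Ideal.Quotient.field _
  haveI := flat_quot _ m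
  haveI : Module.Flat A (K ⧸ m.asIdeal) := Module.Flat.trans A K _
  obtain ⟨ψ, hψ⟩ := hb (K ⧸ m.asIdeal)
  refine perm g (Spec.map b) (Spec.map (CommRingCat.ofHom ψ)) ?_
  rw [← hψ, CommRingCat.ofHom_comp, Spec.map_comp]
  rfl

lemma main_aux {A B : Type u} [CommRing A] [IsNoetherianRing A] [_root_.IsReduced A]
    [CommRing B] [Algebra A B] [Algebra.Etale A B]
    {Y : Scheme.{u}} (g : Y ⟶ Spec (CommRingCat.of B)) (hg : IsMMorphism g) :
    ∃ (X : Scheme.{u}) (f : X ⟶ Spec (CommRingCat.of A)),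
      IsMMorphism f ∧
      ∃ h : pullback f (Spec.map (CommRingCat.ofHom (algebraMap A B))) ⟶ Y,
        h ≫ g = pullback.snd f (Spec.map (CommRingCat.ofHom (algebraMap A B))) := by
  obtain ⟨h1, h2, h3, h4, h5⟩ := frac_facts A
  obtain ⟨hg1, hg2, hg3⟩ := hg
  obtain ⟨X, f, hf, hiso, hφ⟩ := main_gen (totalFractionMap A) h3 h4 h5 (totalFractionMap B)
    (fun κ _ _ _ _ => lift_fr A B κ) g
  exact ⟨X, f, ⟨hf, lfp_of_noeth f, hiso⟩, hφ⟩
end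

/-- If `A` is a Noetherian reduced ring and `A → B` is étale, then any M-morphism
`g : Y ⟶ Spec B` is dominated by (the base change of) an M-morphism `f : X ⟶ Spec A`:
there is a morphism `X ×_{Spec A} Spec B ⟶ Y` over `Spec B`. -/
theorem stmt9 {A B : Type u} [CommRing A] [IsNoetherianRing A] [IsReduced A]
    [CommRing B] [Algebra A B] [Algebra.Etale A B]
    {Y : Scheme.{u}} (g : Y ⟶ Spec (CommRingCat.of B)) (hg : IsMMorphism g) :
    ∃ (X : Scheme.{u}) (f : X ⟶ Spec (CommRingCat.of A)),
      IsMMorphism f ∧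
      ∃ h : pullback f (Spec.map (CommRingCat.ofHom (algebraMap A B))) ⟶ Y,
        h ≫ g = pullback.snd f (Spec.map (CommRingCat.ofHom (algebraMap A B))) := by
  exact main_aux g hg
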